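/- arXiv:1807.09654 — 4 statements merged into one kernel-verified Lean document; each statement's English description precedes it below -/
import Mathlib

section
/- Let 𝒰 ⊆ ℝ⁷ be an open convex set (with coordinates written (x,y,p,q,r,s,t)) and let F : 𝒰 → ℝ be of class C³ satisfying: (i) ∂F/∂r > 0 and 4(∂F/∂r)(∂F/∂t) − (∂F/∂s)² > 0 at every point of 𝒰; (ii) there exists α ∈ ℝ such that p₀ := (0,0,0,0,α,0,α) ∈ 𝒰 and F(p₀) = 0; (iii) F is rotationally invariant. Then there exist δ > 0 and a radial function u of class C² on the open disk D(0,δ) ⊆ ℝ² such that for every (x,y) ∈ D(0,δ) the 7-tuple (x, y, u_x(x,y), u_y(x,y), u_xx(x,y), u_xy(x,y), u_yy(x,y)) lies in 𝒰 and F(x, y, u_x, u_y, u_xx, u_xy, u_yy) = 0 at (x,y). -/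
open Set Filter Topology

/-- The open Euclidean disk of radius `δ` centered at the origin of `ℝ²`. -/
def disk (δ : ℝ) : Set (ℝ × ℝ) := {z : ℝ × ℝ | z.1 ^ 2 + z.2 ^ 2 < δ ^ 2}

/-- The 2-jet `(x, y, u_x, u_y, u_xx, u_xy, u_yy)` of `u : ℝ × ℝ → ℝ` at a point. -/
noncomputable def jet2 (u : ℝ × ℝ → ℝ) (z : ℝ × ℝ) : Fin 7 → ℝ :=
  ![z.1, z.2,
    fderiv ℝ u z (1, 0),
    fderiv ℝ u z (0, 1),
    fderiv ℝ (fun w => fderiv ℝ u w (1, 0)) z (1, 0),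
    fderiv ℝ (fun w => fderiv ℝ u w (1, 0)) z (0, 1),
    fderiv ℝ (fun w => fderiv ℝ u w (0, 1)) z (0, 1)]

/-- The action of the rotation of angle `θ` on a 7-tuple `(x,y,p,q,r,s,t)`:
`(x,y)` and `(p,q)` rotate as vectors, and `[[r,s],[s,t]]` transforms as
`R_θ · [[r,s],[s,t]] · R_θ⁻¹`. -/
noncomputable def rotate7 (θ : ℝ) (P : Fin 7 → ℝ) : Fin 7 → ℝ :=
  ![Real.cos θ * P 0 - Real.sin θ * P 1,
    Real.sin θ * P 0 + Real.cos θ * P 1,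
    Real.cos θ * P 2 - Real.sin θ * P 3,
    Real.sin θ * P 2 + Real.cos θ * P 3,
    Real.cos θ ^ 2 * P 4 - 2 * Real.cos θ * Real.sin θ * P 5 + Real.sin θ ^ 2 * P 6,
    Real.cos θ * Real.sin θ * P 4 + (Real.cos θ ^ 2 - Real.sin θ ^ 2) * P 5
      - Real.cos θ * Real.sin θ * P 6,
    Real.sin θ ^ 2 * P 4 + 2 * Real.cos θ * Real.sin θ * P 5 + Real.cos θ ^ 2 * P 6]

/-- `F` is rotationally invariant on `U`. -/
def RotInvariant (F : (Fin 7 → ℝ) → ℝ) (U : Set (Fin 7 → ℝ)) : Prop :=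
  ∀ θ : ℝ, ∀ P : Fin 7 → ℝ, P ∈ U → rotate7 θ P ∈ U → F P = F (rotate7 θ P)

/-- `u` is radial on `s`: it depends only on `x² + y²`. -/
def IsRadial (u : ℝ × ℝ → ℝ) (s : Set (ℝ × ℝ)) : Prop :=
  ∃ g : ℝ → ℝ, ∀ z ∈ s, u z = g (z.1 ^ 2 + z.2 ^ 2)

/-- Half of the mean value of `g` over the segment from `0` to `m`. -/
noncomputable def halfMean (g : ℝ → ℝ) (m : ℝ) : ℝ := (∫ τ in (0 : ℝ)..1, g (τ * m)) / 2

theorem halfMean_zero (g : ℝ → ℝ) : halfMean g 0 = g 0 / 2 := by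
  simp [halfMean]

theorem continuous_halfMean {g : ℝ → ℝ} (hg : Continuous g) : Continuous (halfMean g) := by
  unfold halfMean
  refine Continuous.div_const ?_ 2
  exact intervalIntegral.continuous_parametric_intervalIntegral_of_continuous'
    (f := fun m τ => g (τ * m)) (by fun_prop) 0 1

theorem abs_halfMean_sub_le {g h : ℝ → ℝ} (hg : Continuous g) (hh : Continuous h) {C : ℝ}
    (hC : ∀ m, |g m - h m| ≤ C) (m : ℝ) : |halfMean g m - halfMean h m| ≤ C := by
  have h1 : halfMean g m - halfMean h m = (∫ τ in (0 : ℝ)..1, (g (τ * m) - h (τ * m))) / 2 := by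
    rw [intervalIntegral.integral_sub]
    · unfold halfMean; ring
    · exact (by fun_prop : Continuous fun τ => g (τ * m)).intervalIntegrable _ _
    · exact (by fun_prop : Continuous fun τ => h (τ * m)).intervalIntegrable _ _
  have h2 := intervalIntegral.norm_integral_le_of_norm_le_const (a := (0 : ℝ)) (b := 1)
    (f := fun τ => g (τ * m) - h (τ * m)) (C := C) (fun τ _ => by simpa using hC (τ * m))
  have h3 : 0 ≤ C := (abs_nonneg _).trans (hC 0)
  rw [h1, abs_div]
  simp only [Real.norm_eq_abs, sub_zero, abs_one, mul_one] at h2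
  rw [abs_two]
  linarith

theorem halfMean_of_ne_zero (g : ℝ → ℝ) {m : ℝ} (hm : m ≠ 0) :
    halfMean g m = (∫ s in (0 : ℝ)..m, g s) / (2 * m) := by
  have := intervalIntegral.integral_comp_mul_right (a := 0) (b := 1) g hm
  unfold halfMean
  rw [this]
  simp
  field_simp

theorem hasDerivAt_halfMean {g : ℝ → ℝ} (hg : Continuous g) {m : ℝ} (hm : m ≠ 0) :
    HasDerivAt (halfMean g) ((g m - 2 * halfMean g m) / (2 * m)) m := by
  have hA : HasDerivAt (fun x => ∫ s in (0 : ℝ)..x, g s) (g m) m :=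
    intervalIntegral.integral_hasDerivAt_right (hg.intervalIntegrable _ _)
      (hg.stronglyMeasurableAtFilter _ _) hg.continuousAt
  have hB := hA.div ((hasDerivAt_id m).const_mul 2) (by simpa using hm)
  have hev : halfMean g =ᶠ[𝓝 m] fun x => (∫ s in (0 : ℝ)..x, g s) / (2 * x) := by
    filter_upwards [isOpen_ne.mem_nhds hm] with x hx using halfMean_of_ne_zero g hx
  refine (hB.congr_of_eventuallyEq hev).congr_deriv ?_
  rw [halfMean_of_ne_zero g hm]
  simp
  field_simp

/-- A functional equation `g m = Ψ (m, g m, halfMean g m)` with contracting right-hand side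
has a continuous solution. -/
theorem exists_eq_halfMean_of_contracting {Ψ : ℝ × ℝ × ℝ → ℝ} (hΨ : Continuous Ψ)
    {B : ℝ} (hB : ∀ a, |Ψ a| ≤ B)
    (hL : ∀ m g w g' w' M, |g - g'| ≤ M → |w - w'| ≤ M →
      |Ψ (m, g, w) - Ψ (m, g', w')| ≤ M / 2) :
    ∃ g : ℝ → ℝ, Continuous g ∧ ∀ m, g m = Ψ (m, g m, halfMean g m) := by
  let T : BoundedContinuousFunction ℝ ℝ → BoundedContinuousFunction ℝ ℝ := fun g =>
    BoundedContinuousFunction.ofNormedAddCommGroup (fun m => Ψ (m, g m, halfMean g m))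
      (by have := continuous_halfMean g.continuous; have := g.continuous; fun_prop) B
      (fun m => hB _)
  have hT : ContractingWith (1 / 2) T := by
    refine ⟨by rw [← NNReal.coe_lt_coe]; norm_num, LipschitzWith.of_dist_le_mul fun g h => ?_⟩
    rw [BoundedContinuousFunction.dist_le (by positivity)]
    intro m
    have hd : ∀ m, |g m - h m| ≤ dist g h := fun m =>
      BoundedContinuousFunction.dist_coe_le_dist (f := g) (g := h) m
    have := hL m (g m) (halfMean g m) (h m) (halfMean h m) (dist g h) (hd m)
      (abs_halfMean_sub_le g.continuous h.continuous hd m)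
    rw [Real.dist_eq]
    refine this.trans (le_of_eq ?_)
    push_cast
    ring
  refine ⟨⇑(ContractingWith.fixedPoint T hT), BoundedContinuousFunction.continuous _, fun m => ?_⟩
  have := hT.fixedPoint_isFixedPt
  conv_lhs => rw [← this]
  rfl

/-- The radial function whose Laplacian is `g (x² + y²)`. -/
noncomputable def radialPotential (g : ℝ → ℝ) (z : ℝ × ℝ) : ℝ :=
  (∫ m in (0 : ℝ)..(z.1 ^ 2 + z.2 ^ 2), halfMean g m) / 2

/-- The coefficient `(g - 2 W) / m` at `m = x² + y²`, where `W = halfMean g`. -/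
noncomputable def hessCoeff (g : ℝ → ℝ) (z : ℝ × ℝ) : ℝ :=
  (g (z.1 ^ 2 + z.2 ^ 2) - 2 * halfMean g (z.1 ^ 2 + z.2 ^ 2)) / (z.1 ^ 2 + z.2 ^ 2)

theorem sq_add_sq_ne_zero {z : ℝ × ℝ} (hz : z ≠ 0) : z.1 ^ 2 + z.2 ^ 2 ≠ 0 := by
  intro h
  apply hz
  ext
  · simp; nlinarith [sq_nonneg z.1, sq_nonneg z.2]
  · simp; nlinarith [sq_nonneg z.1, sq_nonneg z.2]

theorem continuous_mul_hessCoeff {g : ℝ → ℝ} (hg : Continuous g) {q : ℝ × ℝ → ℝ}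
    (hq : Continuous q) (hle : ∀ z, |q z| ≤ z.1 ^ 2 + z.2 ^ 2) :
    Continuous fun z => q z * hessCoeff g z := by
  have hW := continuous_halfMean hg
  rw [continuous_iff_continuousAt]
  intro z
  by_cases hz : z = 0
  · subst hz
    have h0 : q 0 * hessCoeff g 0 = 0 := by simp [hessCoeff]
    rw [ContinuousAt, h0]
    have hlim : Tendsto (fun z : ℝ × ℝ =>
        |g (z.1 ^ 2 + z.2 ^ 2) - 2 * halfMean g (z.1 ^ 2 + z.2 ^ 2)|) (𝓝 0) (𝓝 0) := by
      have : Continuous (fun z : ℝ × ℝ =>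
        |g (z.1 ^ 2 + z.2 ^ 2) - 2 * halfMean g (z.1 ^ 2 + z.2 ^ 2)|) := by fun_prop
      have h := this.tendsto 0
      have e : g 0 - 2 * halfMean g 0 = 0 := by rw [halfMean_zero]; ring
      simpa [e] using h
    refine squeeze_zero_norm (fun z => ?_) hlim
    rw [Real.norm_eq_abs, abs_mul, hessCoeff, abs_div]
    have hm : 0 ≤ z.1 ^ 2 + z.2 ^ 2 := by positivity
    rw [abs_of_nonneg hm, mul_div_assoc', mul_comm]
    exact div_le_of_le_mul₀ hm (abs_nonneg _)
      (mul_le_mul_of_nonneg_left (hle z) (abs_nonneg _))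
  · unfold hessCoeff
    refine hq.continuousAt.mul (ContinuousAt.div ?_ ?_ (sq_add_sq_ne_zero hz))
    · exact Continuous.continuousAt (by fun_prop)
    · exact Continuous.continuousAt (by fun_prop)

theorem hasFDerivAt_sq_add_sq (z : ℝ × ℝ) :
    HasFDerivAt (fun z : ℝ × ℝ => z.1 ^ 2 + z.2 ^ 2)
      ((2 * z.1) • ContinuousLinearMap.fst ℝ ℝ ℝ + (2 * z.2) • ContinuousLinearMap.snd ℝ ℝ ℝ)
      z := by
  have h := ((hasFDerivAt_fst (𝕜 := ℝ) (p := z)).pow 2).add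
    ((hasFDerivAt_snd (𝕜 := ℝ) (p := z)).pow 2)
  refine h.congr_fderiv ?_
  simp

theorem hasFDerivAt_radialPotential {g : ℝ → ℝ} (hg : Continuous g) (z : ℝ × ℝ) :
    HasFDerivAt (radialPotential g)
      ((z.1 * halfMean g (z.1 ^ 2 + z.2 ^ 2)) • ContinuousLinearMap.fst ℝ ℝ ℝ +
        (z.2 * halfMean g (z.1 ^ 2 + z.2 ^ 2)) • ContinuousLinearMap.snd ℝ ℝ ℝ) z := by
  have hW := continuous_halfMean hg
  have hA : HasDerivAt (fun x => (∫ s in (0 : ℝ)..x, halfMean g s) / 2)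
      (halfMean g (z.1 ^ 2 + z.2 ^ 2) / 2) (z.1 ^ 2 + z.2 ^ 2) :=
    (intervalIntegral.integral_hasDerivAt_right (hW.intervalIntegrable _ _)
      (hW.stronglyMeasurableAtFilter _ _) hW.continuousAt).div_const 2
  have h := hA.comp_hasFDerivAt z (hasFDerivAt_sq_add_sq z)
  refine h.congr_fderiv ?_
  ext <;> simp <;> ring

/-- Derivative of `z ↦ ℓ z * halfMean g (x² + y²)` for a linear form `ℓ`. -/
theorem hasFDerivAt_mul_halfMean {g : ℝ → ℝ} (hg : Continuous g) (l : ℝ × ℝ →L[ℝ] ℝ)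
    (z : ℝ × ℝ) :
    HasFDerivAt (fun z : ℝ × ℝ => l z * halfMean g (z.1 ^ 2 + z.2 ^ 2))
      (halfMean g (z.1 ^ 2 + z.2 ^ 2) • l +
        ((l z * z.1 * hessCoeff g z) • ContinuousLinearMap.fst ℝ ℝ ℝ +
          (l z * z.2 * hessCoeff g z) • ContinuousLinearMap.snd ℝ ℝ ℝ)) z := by
  by_cases hz : z = 0
  · subst hz
    have hW : Continuous fun z : ℝ × ℝ => halfMean g (z.1 ^ 2 + z.2 ^ 2) := by
      have := continuous_halfMean hg
      fun_prop
    rw [hasFDerivAt_iff_isLittleO_nhds_zero]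
    have h1 : (fun h : ℝ × ℝ => halfMean g (h.1 ^ 2 + h.2 ^ 2) - halfMean g 0)
        =o[𝓝 0] fun _ => (1 : ℝ) := by
      rw [Asymptotics.isLittleO_one_iff]
      have hsub : Continuous fun h : ℝ × ℝ =>
          halfMean g (h.1 ^ 2 + h.2 ^ 2) - halfMean g 0 := by fun_prop
      simpa using hsub.tendsto 0
    have h2 := (l.isBigO_id (𝓝 0)).norm_right.mul_isLittleO h1
    simp only [mul_one] at h2
    refine h2.of_norm_right.congr_left fun h => ?_
    simp
    ring
  · have hm := sq_add_sq_ne_zero hz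
    have hW := (hasDerivAt_halfMean hg hm).comp_hasFDerivAt z (hasFDerivAt_sq_add_sq z)
    have h := l.hasFDerivAt (x := z) |>.mul hW
    refine h.congr_fderiv ?_
    ext <;> simp [hessCoeff] <;> field_simp <;> ring

theorem continuous_fderiv_mul_halfMean {g : ℝ → ℝ} (hg : Continuous g) (l : ℝ × ℝ →L[ℝ] ℝ)
    (hl : ∀ z : ℝ × ℝ, |l z * z.1| ≤ z.1 ^ 2 + z.2 ^ 2 ∧ |l z * z.2| ≤ z.1 ^ 2 + z.2 ^ 2) :
    Continuous (fderiv ℝ fun z : ℝ × ℝ => l z * halfMean g (z.1 ^ 2 + z.2 ^ 2)) := by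
  rw [funext fun z => (hasFDerivAt_mul_halfMean hg l z).fderiv]
  have hW := continuous_halfMean hg
  have h1 := continuous_mul_hessCoeff hg (q := fun z => l z * z.1) (by fun_prop)
    fun z => (hl z).1
  have h2 := continuous_mul_hessCoeff hg (q := fun z => l z * z.2) (by fun_prop)
    fun z => (hl z).2
  fun_prop

theorem contDiff_one_mul_halfMean {g : ℝ → ℝ} (hg : Continuous g) (l : ℝ × ℝ →L[ℝ] ℝ)
    (hl : ∀ z : ℝ × ℝ, |l z * z.1| ≤ z.1 ^ 2 + z.2 ^ 2 ∧ |l z * z.2| ≤ z.1 ^ 2 + z.2 ^ 2) :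
    ContDiff ℝ 1 (fun z : ℝ × ℝ => l z * halfMean g (z.1 ^ 2 + z.2 ^ 2)) :=
  contDiff_one_iff_fderiv.2 ⟨fun z => (hasFDerivAt_mul_halfMean hg l z).differentiableAt,
    continuous_fderiv_mul_halfMean hg l hl⟩

theorem abs_fst_mul_le (z : ℝ × ℝ) :
    |ContinuousLinearMap.fst ℝ ℝ ℝ z * z.1| ≤ z.1 ^ 2 + z.2 ^ 2 ∧
    |ContinuousLinearMap.fst ℝ ℝ ℝ z * z.2| ≤ z.1 ^ 2 + z.2 ^ 2 := by
  simp only [ContinuousLinearMap.coe_fst', abs_le]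
  refine ⟨⟨?_, ?_⟩, ?_, ?_⟩ <;>
    nlinarith [sq_nonneg (z.1 + z.2), sq_nonneg (z.1 - z.2), sq_nonneg z.1, sq_nonneg z.2]

theorem abs_snd_mul_le (z : ℝ × ℝ) :
    |ContinuousLinearMap.snd ℝ ℝ ℝ z * z.1| ≤ z.1 ^ 2 + z.2 ^ 2 ∧
    |ContinuousLinearMap.snd ℝ ℝ ℝ z * z.2| ≤ z.1 ^ 2 + z.2 ^ 2 := by
  simp only [ContinuousLinearMap.coe_snd', abs_le]
  refine ⟨⟨?_, ?_⟩, ?_, ?_⟩ <;>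
    nlinarith [sq_nonneg (z.1 + z.2), sq_nonneg (z.1 - z.2), sq_nonneg z.1, sq_nonneg z.2]

theorem contDiff_radialPotential {g : ℝ → ℝ} (hg : Continuous g) :
    ContDiff ℝ 2 (radialPotential g) := by
  rw [show (2 : WithTop ℕ∞) = 1 + 1 by norm_num, contDiff_succ_iff_fderiv]
  refine ⟨fun z => (hasFDerivAt_radialPotential hg z).differentiableAt, by simp, ?_⟩
  rw [funext fun z => (hasFDerivAt_radialPotential hg z).fderiv]
  exact ((contDiff_one_mul_halfMean hg _ abs_fst_mul_le).smul contDiff_const).add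
    ((contDiff_one_mul_halfMean hg _ abs_snd_mul_le).smul contDiff_const)

theorem jet2_radialPotential {g : ℝ → ℝ} (hg : Continuous g) (z : ℝ × ℝ) :
    jet2 (radialPotential g) z =
      ![z.1, z.2, z.1 * halfMean g (z.1 ^ 2 + z.2 ^ 2), z.2 * halfMean g (z.1 ^ 2 + z.2 ^ 2),
        halfMean g (z.1 ^ 2 + z.2 ^ 2) + z.1 * z.1 * hessCoeff g z,
        z.1 * z.2 * hessCoeff g z,
        halfMean g (z.1 ^ 2 + z.2 ^ 2) + z.2 * z.2 * hessCoeff g z] := by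
  have hx : (fun w => fderiv ℝ (radialPotential g) w (1, 0)) = fun z : ℝ × ℝ =>
      ContinuousLinearMap.fst ℝ ℝ ℝ z * halfMean g (z.1 ^ 2 + z.2 ^ 2) := by
    funext w
    rw [(hasFDerivAt_radialPotential hg w).fderiv]
    simp
  have hy : (fun w => fderiv ℝ (radialPotential g) w (0, 1)) = fun z : ℝ × ℝ =>
      ContinuousLinearMap.snd ℝ ℝ ℝ z * halfMean g (z.1 ^ 2 + z.2 ^ 2) := by
    funext w
    rw [(hasFDerivAt_radialPotential hg w).fderiv]
    simp
  rw [jet2, hx, hy, (hasFDerivAt_mul_halfMean hg _ z).fderiv,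
    (hasFDerivAt_mul_halfMean hg _ z).fderiv, (hasFDerivAt_radialPotential hg z).fderiv]
  simp

theorem continuous_jet2_radialPotential {g : ℝ → ℝ} (hg : Continuous g) :
    Continuous (jet2 (radialPotential g)) := by
  rw [funext (jet2_radialPotential hg)]
  have hW := continuous_halfMean hg
  have h1 := continuous_mul_hessCoeff hg (q := fun z => z.1 * z.1) (by fun_prop)
    fun z => (abs_fst_mul_le z).1
  have h2 := continuous_mul_hessCoeff hg (q := fun z => z.1 * z.2) (by fun_prop)
    fun z => (abs_fst_mul_le z).2
  have h3 := continuous_mul_hessCoeff hg (q := fun z => z.2 * z.2) (by fun_prop)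
    fun z => (abs_snd_mul_le z).2
  refine continuous_pi fun i => ?_
  fin_cases i <;> simp <;> fun_prop

/-- The 2-jet at `(ρ, 0)` of a radial function with Laplacian `g` and `u_x = ρ w` there. -/
def axisJet (a : ℝ × ℝ × ℝ) : Fin 7 → ℝ :=
  ![a.1, 0, a.1 * a.2.2, 0, a.2.1 - a.2.2, 0, a.2.2]

theorem continuous_axisJet : Continuous axisJet := by
  unfold axisJet
  refine continuous_pi fun i => ?_
  fin_cases i <;> simp <;> fun_prop

theorem exists_jet2_eq_rotate7 {g : ℝ → ℝ} (hg : Continuous g) (z : ℝ × ℝ) :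
    ∃ θ, jet2 (radialPotential g) z = rotate7 θ (axisJet (√(z.1 ^ 2 + z.2 ^ 2),
      g (z.1 ^ 2 + z.2 ^ 2), halfMean g (z.1 ^ 2 + z.2 ^ 2))) := by
  rw [jet2_radialPotential hg]
  by_cases hz : z = 0
  · refine ⟨0, ?_⟩
    subst hz
    have e : g 0 - halfMean g 0 = halfMean g 0 := by rw [halfMean_zero]; ring
    simp [rotate7, axisJet, e]
  · have hm := sq_add_sq_ne_zero hz
    have hc : z.1 = √(z.1 ^ 2 + z.2 ^ 2) * Real.cos (Complex.arg ⟨z.1, z.2⟩) := by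
      have := Complex.norm_mul_cos_arg ⟨z.1, z.2⟩
      rw [Complex.norm_def, Complex.normSq_mk, ← pow_two, ← pow_two] at this
      exact this.symm
    have hs : z.2 = √(z.1 ^ 2 + z.2 ^ 2) * Real.sin (Complex.arg ⟨z.1, z.2⟩) := by
      have := Complex.norm_mul_sin_arg ⟨z.1, z.2⟩
      rw [Complex.norm_def, Complex.normSq_mk, ← pow_two, ← pow_two] at this
      exact this.symm
    have hρ : √(z.1 ^ 2 + z.2 ^ 2) ^ 2 = z.1 ^ 2 + z.2 ^ 2 := Real.sq_sqrt (by positivity)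
    refine ⟨Complex.arg ⟨z.1, z.2⟩, ?_⟩
    have hk : √(z.1 ^ 2 + z.2 ^ 2) ^ 2 * hessCoeff g z =
        g (z.1 ^ 2 + z.2 ^ 2) - 2 * halfMean g (z.1 ^ 2 + z.2 ^ 2) := by
      rw [hρ, hessCoeff, mul_div_cancel₀ _ hm]
    have hcs := Real.sin_sq_add_cos_sq (Complex.arg ⟨z.1, z.2⟩)
    generalize Complex.arg ⟨z.1, z.2⟩ = θ at *
    generalize hessCoeff g z = k at *
    generalize halfMean g (z.1 ^ 2 + z.2 ^ 2) = w at *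
    generalize g (z.1 ^ 2 + z.2 ^ 2) = γ at *
    generalize √(z.1 ^ 2 + z.2 ^ 2) = ρ at *
    rw [hc, hs]
    ext i
    fin_cases i <;> simp [rotate7, axisJet]
    iterate 4 · ring
    · linear_combination Real.cos θ ^ 2 * hk - w * hcs
    · linear_combination Real.cos θ * Real.sin θ * hk
    · linear_combination Real.sin θ ^ 2 * hk - w * hcs

/-- At an umbilical jet a rotationally invariant `F` satisfies `F_r = F_t`. -/
theorem RotInvariant.fderiv_single_four_eq {F : (Fin 7 → ℝ) → ℝ} {U : Set (Fin 7 → ℝ)}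
    (hrot : RotInvariant F U) {α : ℝ} (hU : U ∈ 𝓝 (![0, 0, 0, 0, α, 0, α] : Fin 7 → ℝ))
    (hF : DifferentiableAt ℝ F ![0, 0, 0, 0, α, 0, α]) :
    fderiv ℝ F ![0, 0, 0, 0, α, 0, α] (Pi.single 4 1) =
      fderiv ℝ F ![0, 0, 0, 0, α, 0, α] (Pi.single 6 1) := by
  set P : Fin 7 → ℝ := ![0, 0, 0, 0, α, 0, α] with hP
  have hline : ∀ v : Fin 7 → ℝ, HasDerivAt (fun ε : ℝ => F (P + ε • v)) (fderiv ℝ F P v) 0 :=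
    fun v => hF.hasFDerivAt.hasLineDerivAt v
  have hmem : ∀ v : Fin 7 → ℝ, ∀ᶠ ε : ℝ in 𝓝 0, P + ε • v ∈ U := fun v => by
    have : Continuous fun ε : ℝ => P + ε • v := by fun_prop
    exact this.continuousAt.eventually_mem (by simpa using hU)
  refine (hline (Pi.single 4 1)).unique ((hline (Pi.single 6 1)).congr_of_eventuallyEq ?_)
  filter_upwards [hmem (Pi.single 4 1), hmem (Pi.single 6 1)] with ε h4 h6
  have e : rotate7 (Real.pi / 2) (P + ε • Pi.single 4 1) = P + ε • Pi.single 6 1 := by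
    ext i
    fin_cases i <;> simp [rotate7, hP]
  rw [← e] at h6 ⊢
  exact hrot _ _ h4 h6

/-- Truncation of `t` to the interval of radius `η` around `c`. -/
noncomputable def truncate (η c t : ℝ) : ℝ := max (c - η) (min (c + η) t)

theorem continuous_truncate (η c : ℝ) : Continuous (truncate η c) := by
  unfold truncate; fun_prop

theorem abs_truncate_sub_le {η : ℝ} (hη : 0 < η) (c t : ℝ) : |truncate η c t - c| ≤ η := by
  unfold truncate
  rw [abs_le]
  constructor
  · linarith [le_max_left (c - η) (min (c + η) t)]
  · linarith [max_le (by linarith : c - η ≤ c + η) (min_le_left (c + η) t)]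

theorem abs_truncate_sub_truncate_le (η c s t : ℝ) :
    |truncate η c s - truncate η c t| ≤ |s - t| := by
  unfold truncate
  refine (abs_max_sub_max_le_max _ _ _ _).trans ?_
  simp only [sub_self, abs_zero]
  refine max_le (abs_nonneg _) ((abs_min_sub_min_le_max _ _ _ _).trans ?_)
  simp

theorem truncate_eq_self {η c t : ℝ} (h : |t - c| ≤ η) : truncate η c t = t := by
  rw [abs_le] at h
  unfold truncate
  rw [min_eq_right (by linarith), max_eq_right (by linarith)]

/-- Near an umbilical zero of `F` where `F_r = F_t = c`, the map
`(ρ, g, w) ↦ g - F (axisJet (ρ, g, w)) / c` is a contraction in `(g, w)`. -/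
theorem exists_contracting_box {F : (Fin 7 → ℝ) → ℝ} {U : Set (Fin 7 → ℝ)} {α : ℝ}
    (hU : U ∈ 𝓝 (![0, 0, 0, 0, α, 0, α] : Fin 7 → ℝ)) {D : (Fin 7 → ℝ) →L[ℝ] ℝ}
    (hF : HasStrictFDerivAt F D ![0, 0, 0, 0, α, 0, α]) {c : ℝ} (hc : 0 < c)
    (h4 : D (Pi.single 4 1) = c) (h6 : D (Pi.single 6 1) = c) :
    ∃ η > 0, ∀ ρ, |ρ| ≤ η → ∀ g w, |g - 2 * α| ≤ η → |w - α| ≤ η →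
      axisJet (ρ, g, w) ∈ U ∧ ∀ g' w', |g' - 2 * α| ≤ η → |w' - α| ≤ η →
        ∀ M, |g - g'| ≤ M → |w - w'| ≤ M →
          |(g - F (axisJet (ρ, g, w)) / c) - (g' - F (axisJet (ρ, g', w')) / c)| ≤ M / 2 := by
  have hc8 : 0 < c / 8 := by positivity
  obtain ⟨s, hs, hlin⟩ := hF.approximates_deriv_on_nhds (c := (c / 8).toNNReal)
    (Or.inr (by simpa using hc8))
  have hax : axisJet (0, 2 * α, α) = ![0, 0, 0, 0, α, 0, α] := by
    simp [axisJet]; ring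
  have hnhds : axisJet ⁻¹' (s ∩ U) ∈ 𝓝 ((0 : ℝ), 2 * α, α) :=
    continuous_axisJet.continuousAt.preimage_mem_nhds (by rw [hax]; exact inter_mem hs hU)
  obtain ⟨r, hr, hball⟩ := Metric.nhds_basis_closedBall.mem_iff.1 hnhds
  set d := |D (Pi.single 2 1)| with hd
  have hd0 : 0 ≤ d := abs_nonneg _
  refine ⟨min (min r 1) (c / (4 * (d + 1))), by positivity, ?_⟩
  intro ρ hρ g w hg hw
  have hbox : ∀ g w, |g - 2 * α| ≤ min (min r 1) (c / (4 * (d + 1))) →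
      |w - α| ≤ min (min r 1) (c / (4 * (d + 1))) → axisJet (ρ, g, w) ∈ s ∩ U := by
    intro g w hg hw
    simp only [le_min_iff] at hρ hg hw
    refine hball ?_
    simp [Prod.dist_eq, Real.dist_eq, hρ, hg, hw]
  refine ⟨(hbox g w hg hw).2, fun g' w' hg' hw' M hgM hwM => ?_⟩
  have hM : 0 ≤ M := (abs_nonneg _).trans hgM
  have hlip := hlin _ (hbox g w hg hw).1 _ (hbox g' w' hg' hw').1
  simp only [le_min_iff] at hρ
  have hdiff : axisJet (ρ, g, w) - axisJet (ρ, g', w') =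
      (ρ * (w - w')) • Pi.single 2 1 + ((g - g') - (w - w')) • Pi.single 4 1 +
        (w - w') • Pi.single 6 1 := by
    ext i
    fin_cases i <;> simp [axisJet] <;> ring
  have hnorm : ‖axisJet (ρ, g, w) - axisJet (ρ, g', w')‖ ≤ 2 * M := by
    rw [pi_norm_le_iff_of_nonneg (by positivity)]
    have h1 : |ρ * w - ρ * w'| ≤ 2 * M := by
      rw [← mul_sub, abs_mul]
      nlinarith [abs_nonneg ρ, abs_nonneg (w - w'), hρ.1.2]
    have h2 : |g - w - (g' - w')| ≤ 2 * M := by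
      rw [abs_le] at *
      constructor <;> linarith [hgM.1, hgM.2, hwM.1, hwM.2]
    have h3 : |w - w'| ≤ 2 * M := by linarith
    intro i
    fin_cases i <;> simp [axisJet, hM, h1, h2, h3]
  rw [Real.coe_toNNReal _ hc8.le, hdiff, map_add, map_add, map_smul, map_smul, map_smul, h4, h6,
    ← hdiff] at hlip
  have hbound : |F (axisJet (ρ, g, w)) - F (axisJet (ρ, g', w')) -
      (ρ * (w - w') * D (Pi.single 2 1) + c * (g - g'))| ≤ c / 4 * M := by
    have e : ρ * (w - w') * D (Pi.single 2 1) + c * (g - g') =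
      (ρ * (w - w')) • D (Pi.single 2 1) + (g - g' - (w - w')) • c + (w - w') • c := by
      simp only [smul_eq_mul]; ring
    rw [e]
    refine hlip.trans ?_
    nlinarith
  have hsmall : |ρ * (w - w') * D (Pi.single 2 1)| ≤ c / 4 * M := by
    rw [abs_mul, abs_mul, ← hd]
    have h1 : |ρ| * (4 * (d + 1)) ≤ c := (le_div_iff₀ (by positivity)).1 hρ.2
    have h2 : |ρ| * d ≤ c / 4 := by nlinarith [abs_nonneg ρ]
    calc |ρ| * |w - w'| * d = (|ρ| * d) * |w - w'| := by ring
      _ ≤ c / 4 * M := by gcongr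
  have e : (g - F (axisJet (ρ, g, w)) / c) - (g' - F (axisJet (ρ, g', w')) / c) =
      -((F (axisJet (ρ, g, w)) - F (axisJet (ρ, g', w')) -
        (ρ * (w - w') * D (Pi.single 2 1) + c * (g - g'))) +
          ρ * (w - w') * D (Pi.single 2 1)) / c := by
    field_simp
    ring
  rw [e, abs_div, abs_neg, abs_of_pos hc, div_le_iff₀ hc]
  refine (abs_add_le _ _).trans ?_
  linarith

/-- Existence of a radial solution, on a small disk, of a rotationally invariant
fully nonlinear elliptic PDE `F(x, y, u_x, u_y, u_xx, u_xy, u_yy) = 0`. -/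
theorem radial_solution_exists
    (U : Set (Fin 7 → ℝ)) (hUopen : IsOpen U) (hUconv : Convex ℝ U)
    (F : (Fin 7 → ℝ) → ℝ) (hF : ContDiffOn ℝ 3 F U)
    (hell : ∀ P ∈ U,
      0 < fderiv ℝ F P (Pi.single 4 1) ∧
      0 < 4 * fderiv ℝ F P (Pi.single 4 1) * fderiv ℝ F P (Pi.single 6 1)
          - (fderiv ℝ F P (Pi.single 5 1)) ^ 2)
    (α : ℝ) (hα_mem : (![0, 0, 0, 0, α, 0, α] : Fin 7 → ℝ) ∈ U)
    (hα_zero : F ![0, 0, 0, 0, α, 0, α] = 0)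
    (hrot : RotInvariant F U) :
    ∃ δ > (0 : ℝ), ∃ u : ℝ × ℝ → ℝ,
      ContDiffOn ℝ 2 u (disk δ) ∧
      IsRadial u (disk δ) ∧
      ∀ z ∈ disk δ, jet2 u z ∈ U ∧ F (jet2 u z) = 0 := by
  have hU : U ∈ 𝓝 (![0, 0, 0, 0, α, 0, α] : Fin 7 → ℝ) := hUopen.mem_nhds hα_mem
  have hstrict := (hF.contDiffAt hU).hasStrictFDerivAt (by norm_num)
  have hc := (hell _ hα_mem).1
  obtain ⟨η, hη, hbox⟩ := exists_contracting_box hU hstrict hc rfl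
    (hrot.fderiv_single_four_eq hU hstrict.differentiableAt).symm
  set c := fderiv ℝ F ![0, 0, 0, 0, α, 0, α] (Pi.single 4 1)
  let τ : ℝ × ℝ × ℝ → ℝ × ℝ × ℝ := fun a =>
    (truncate η 0 √a.1, truncate η (2 * α) a.2.1, truncate η α a.2.2)
  have hτ : Continuous τ := by
    have h0 := continuous_truncate η 0
    have h1 := continuous_truncate η (2 * α)
    have h2 := continuous_truncate η α
    fun_prop
  have hτ0 : ∀ t, |truncate η 0 t| ≤ η := fun t => by
    simpa using abs_truncate_sub_le hη 0 t
  have hboxU : ∀ b ∈ Metric.closedBall ((0 : ℝ), 2 * α, α) η, axisJet b ∈ U := by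
    rintro ⟨ρ, g, w⟩ hb
    simp only [Metric.mem_closedBall, Prod.dist_eq, Real.dist_eq, sub_zero, max_le_iff] at hb
    exact (hbox ρ hb.1 g w hb.2.1 hb.2.2).1
  have hτmem : ∀ a, τ a ∈ Metric.closedBall ((0 : ℝ), 2 * α, α) η := fun a => by
    simp [τ, Prod.dist_eq, Real.dist_eq, hτ0, abs_truncate_sub_le hη]
  let Φ : ℝ × ℝ × ℝ → ℝ := fun b => b.2.1 - F (axisJet b) / c
  have hΦ : ContinuousOn Φ (Metric.closedBall ((0 : ℝ), 2 * α, α) η) := by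
    refine ContinuousOn.sub (by fun_prop) (ContinuousOn.div_const ?_ c)
    exact hF.continuousOn.comp continuous_axisJet.continuousOn hboxU
  obtain ⟨B, hB⟩ := (isCompact_closedBall ((0 : ℝ), 2 * α, α) η).exists_bound_of_continuousOn hΦ
  have hL : ∀ m g w g' w' M, |g - g'| ≤ M → |w - w'| ≤ M →
      |Φ (τ (m, g, w)) - Φ (τ (m, g', w'))| ≤ M / 2 := fun m g w g' w' M hg hw =>
    (hbox _ (hτ0 _) _ _ (abs_truncate_sub_le hη _ _) (abs_truncate_sub_le hη _ _)).2 _ _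
      (abs_truncate_sub_le hη _ _) (abs_truncate_sub_le hη _ _) M
      ((abs_truncate_sub_truncate_le _ _ _ _).trans hg)
      ((abs_truncate_sub_truncate_le _ _ _ _).trans hw)
  obtain ⟨g, hg, hfix⟩ := exists_eq_halfMean_of_contracting (Ψ := fun a => Φ (τ a))
    (hΦ.comp_continuous hτ hτmem) (fun a => hB _ (hτmem a)) hL
  have hτ_self : ∀ {a : ℝ × ℝ × ℝ}, |√a.1| ≤ η → |a.2.1 - 2 * α| ≤ η → |a.2.2 - α| ≤ η →
      τ a = (√a.1, a.2) := fun h0 h1 h2 => by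
    simp [τ, truncate_eq_self h1, truncate_eq_self h2,
      truncate_eq_self (c := 0) (by simpa using h0)]
  have hax : axisJet (0, 2 * α, α) = ![0, 0, 0, 0, α, 0, α] := by
    simp [axisJet]; ring
  have hg0 : g 0 = 2 * α := by
    have h1 : Φ (τ (0, 2 * α, α)) = 2 * α := by
      rw [hτ_self (by simpa using hη.le) (by simpa using hη.le) (by simpa using hη.le)]
      simp [Φ, hax, hα_zero]
    have h2 := hL 0 (g 0) (g 0 / 2) (2 * α) α |g 0 - 2 * α| le_rfl (by
      rw [show g 0 / 2 - α = (g 0 - 2 * α) / 2 by ring, abs_div, abs_two]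
      linarith [abs_nonneg (g 0 - 2 * α)])
    rw [h1, ← halfMean_zero, ← hfix 0] at h2
    have h3 : |g 0 - 2 * α| = 0 := by linarith [abs_nonneg (g 0 - 2 * α)]
    linarith [abs_eq_zero.1 h3]
  have hW0 : halfMean g 0 = α := by rw [halfMean_zero, hg0]; ring
  have hW := continuous_halfMean hg
  have hjet : ∀ᶠ z in 𝓝 (0 : ℝ × ℝ), jet2 (radialPotential g) z ∈ U := by
    refine (continuous_jet2_radialPotential hg).continuousAt.eventually_mem ?_
    rw [jet2_radialPotential hg]
    simpa [hW0] using hU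
  have hsmall : ∀ {f : ℝ → ℝ} {a : ℝ}, Continuous f → f 0 = a →
      ∀ᶠ z : ℝ × ℝ in 𝓝 0, |f (z.1 ^ 2 + z.2 ^ 2) - a| ≤ η := by
    intro f a hf hfa
    have hcont : Continuous fun z : ℝ × ℝ => |f (z.1 ^ 2 + z.2 ^ 2) - a| := by fun_prop
    have hlt := hcont.continuousAt.eventually_lt (x₀ := (0 : ℝ × ℝ))
      (continuousAt_const (y := η)) (by simpa [hfa] using hη)
    exact hlt.mono fun z hz => hz.le
  obtain ⟨δ, hδ, hball⟩ := Metric.eventually_nhds_iff_ball.1 (hjet.and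
    ((hsmall Real.continuous_sqrt Real.sqrt_zero).and ((hsmall hg hg0).and (hsmall hW hW0))))
  refine ⟨δ, hδ, radialPotential g, (contDiff_radialPotential hg).contDiffOn,
    ⟨fun m => (∫ t in (0 : ℝ)..m, halfMean g t) / 2, fun z _ => rfl⟩, fun z hz => ?_⟩
  have hzb : z ∈ Metric.ball (0 : ℝ × ℝ) δ := by
    have hz' : z.1 ^ 2 + z.2 ^ 2 < δ ^ 2 := hz
    simp only [Metric.mem_ball, Prod.dist_eq, Real.dist_eq, Prod.fst_zero, Prod.snd_zero,
      sub_zero, max_lt_iff]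
    exact ⟨abs_lt_of_sq_lt_sq (by nlinarith [sq_nonneg z.2]) hδ.le,
      abs_lt_of_sq_lt_sq (by nlinarith [sq_nonneg z.1]) hδ.le⟩
  obtain ⟨hzU, hzm, hzg, hzw⟩ := hball z hzb
  refine ⟨hzU, ?_⟩
  rw [sub_zero] at hzm
  obtain ⟨θ, hθ⟩ := exists_jet2_eq_rotate7 hg z
  have hfz := hfix (z.1 ^ 2 + z.2 ^ 2)
  rw [hτ_self hzm hzg hzw] at hfz
  rw [hθ] at hzU ⊢
  rw [← hrot θ _ (hbox _ hzm _ _ hzg hzw).1 hzU]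
  have hquot : F (axisJet (√(z.1 ^ 2 + z.2 ^ 2), g (z.1 ^ 2 + z.2 ^ 2),
      halfMean g (z.1 ^ 2 + z.2 ^ 2))) / c = 0 := by
    simp only [Φ] at hfz
    linarith
  exact (div_eq_zero_iff.1 hquot).resolve_right hc.ne'
end

section
/- Let 𝒰 ⊆ ℝ⁷ be an open convex set (with coordinates written (x,y,p,q,r,s,t)) and let F : 𝒰 → ℝ be of class C³ satisfying: (i) ∂F/∂r > 0 and 4(∂F/∂r)(∂F/∂t) − (∂F/∂s)² > 0 at every point of 𝒰; (ii) there exists α ∈ ℝ such that p₀ := (0,0,0,0,α,0,α) ∈ 𝒰 and F(p₀) = 0; (iii) F is rotationally invariant. Suppose u and v are radial functions of class C² on the open disks D(0,δ) and D(0,δ') respectively (δ, δ' > 0), whose 2-jets (x, y, ∇u, ∇²u), respectively (x, y, ∇v, ∇²v), lie in 𝒰 at every point, and which satisfy F(x,y,u_x,u_y,u_xx,u_xy,u_yy) = 0 on D(0,δ) and F(x,y,v_x,v_y,v_xx,v_xy,v_yy) = 0 on D(0,δ'). Then there is a constant c ∈ ℝ such that v = u + c on D(0, min(δ,δ')). 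-/
open Set Filter Topology

lemma isOpen_disk (δ : ℝ) : IsOpen (disk δ) :=
  isOpen_lt (by fun_prop) continuous_const

lemma mk_zero_mem_disk {δ x : ℝ} (hx : 0 ≤ x) (hxδ : x < δ) : (x, (0 : ℝ)) ∈ disk δ := by
  change x ^ 2 + (0 : ℝ) ^ 2 < δ ^ 2
  nlinarith

/-- The differential of a function invariant under a linear automorphism `L`. -/
lemma fderiv_apply_of_invariant {f : ℝ × ℝ → ℝ} {s : Set (ℝ × ℝ)} (hs : IsOpen s)
    (L : (ℝ × ℝ) ≃L[ℝ] (ℝ × ℝ)) (hf : ∀ z ∈ s, f (L z) = f z) {z : ℝ × ℝ} (hz : z ∈ s)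
    (e : ℝ × ℝ) : fderiv ℝ f (L z) (L e) = fderiv ℝ f z e := by
  have h : f ∘ L =ᶠ[𝓝 z] f := by
    filter_upwards [hs.mem_nhds hz] with w hw using hf w hw
  rw [← h.fderiv_eq, L.comp_right_fderiv]
  rfl

/-- The reflection `(x, y) ↦ (x, -y)`. -/
def reflectSnd : (ℝ × ℝ) ≃L[ℝ] (ℝ × ℝ) :=
  (ContinuousLinearEquiv.refl ℝ ℝ).prodCongr (ContinuousLinearEquiv.neg ℝ)

lemma reflectSnd_apply (z : ℝ × ℝ) : reflectSnd z = (z.1, -z.2) := rfl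

lemma IsRadial.comp_eq {u : ℝ × ℝ → ℝ} {δ : ℝ} (hu : IsRadial u (disk δ)) {z w : ℝ × ℝ}
    (hz : z ∈ disk δ) (h : w.1 ^ 2 + w.2 ^ 2 = z.1 ^ 2 + z.2 ^ 2) : u w = u z := by
  obtain ⟨g, hg⟩ := hu
  have hw : w ∈ disk δ := h.trans_lt hz
  rw [hg z hz, hg w hw, h]

lemma IsRadial.fderiv_snd_eq_zero {u : ℝ × ℝ → ℝ} {δ : ℝ} (hu : IsRadial u (disk δ)) {x : ℝ}
    (hx : (x, (0 : ℝ)) ∈ disk δ) : fderiv ℝ u (x, 0) (0, 1) = 0 := by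
  have h := fderiv_apply_of_invariant (isOpen_disk δ) reflectSnd
    (fun z hz => hu.comp_eq hz (by simp [reflectSnd_apply])) hx (0, 1)
  have h2 : ((0 : ℝ), (-1 : ℝ)) = -(0, 1) := by simp
  simp only [reflectSnd_apply, neg_zero, h2, map_neg] at h
  linarith

lemma IsRadial.fderiv_zero_eq_zero {u : ℝ × ℝ → ℝ} {δ : ℝ} (hδ : 0 < δ)
    (hu : IsRadial u (disk δ)) (e : ℝ × ℝ) : fderiv ℝ u (0, 0) e = 0 := by
  have h := fderiv_apply_of_invariant (isOpen_disk δ) (ContinuousLinearEquiv.neg ℝ)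
    (fun z hz => hu.comp_eq hz (by simp)) (mk_zero_mem_disk le_rfl hδ) e
  simp only [ContinuousLinearEquiv.coe_neg, Pi.neg_apply, id, Prod.neg_mk, neg_zero, map_neg] at h
  linarith

lemma IsRadial.fderiv_fderiv_mixed_eq_zero {u : ℝ × ℝ → ℝ} {δ : ℝ} (hu : IsRadial u (disk δ))
    {x : ℝ} (hx : (x, (0 : ℝ)) ∈ disk δ) :
    fderiv ℝ (fun w => fderiv ℝ u w (1, 0)) (x, 0) (0, 1) = 0 := by
  have hinv : ∀ z ∈ disk δ, fderiv ℝ u (reflectSnd z) (1, 0) = fderiv ℝ u z (1, 0) := by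
    intro z hz
    have h := fderiv_apply_of_invariant (isOpen_disk δ) reflectSnd
      (fun z hz => hu.comp_eq hz (by simp [reflectSnd_apply])) hz (1, 0)
    rwa [show reflectSnd (1, 0) = (1, 0) by simp [reflectSnd_apply]] at h
  have h := fderiv_apply_of_invariant (f := fun w => fderiv ℝ u w (1, 0)) (isOpen_disk δ)
    reflectSnd hinv hx (0, 1)
  have h2 : ((0 : ℝ), (-1 : ℝ)) = -(0, 1) := by simp
  simp only [reflectSnd_apply, neg_zero, h2, map_neg] at h
  linarith

/-- The angular derivative of a radial function vanishes. -/
lemma IsRadial.angular_fderiv_eq_zero {u : ℝ × ℝ → ℝ} {δ : ℝ} (hu : IsRadial u (disk δ))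
    {z : ℝ × ℝ} (hz : z ∈ disk δ) (hd : DifferentiableAt ℝ u z) :
    z.1 * fderiv ℝ u z (0, 1) = z.2 * fderiv ℝ u z (1, 0) := by
  set γ : ℝ → ℝ × ℝ := fun θ =>
    (z.1 * Real.cos θ - z.2 * Real.sin θ, z.1 * Real.sin θ + z.2 * Real.cos θ) with hγdef
  have hγ0 : γ 0 = z := by simp [hγdef]
  have hγ : HasDerivAt γ (-z.2, z.1) 0 := by
    have h1 := ((Real.hasDerivAt_cos 0).const_mul z.1).fun_sub
      ((Real.hasDerivAt_sin 0).const_mul z.2)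
    have h2 := ((Real.hasDerivAt_sin 0).const_mul z.1).fun_add
      ((Real.hasDerivAt_cos 0).const_mul z.2)
    exact (h1.prodMk h2).congr_deriv (by simp)
  have hcomp : HasDerivAt (u ∘ γ) (fderiv ℝ u z (-z.2, z.1)) 0 := by
    have hd' : HasFDerivAt u (fderiv ℝ u z) (γ 0) := by rw [hγ0]; exact hd.hasFDerivAt
    exact hd'.comp_hasDerivAt 0 hγ
  have hconst : u ∘ γ = fun _ => u z := by
    funext θ
    refine hu.comp_eq hz ?_
    simp only [hγdef]
    linear_combination (z.1 ^ 2 + z.2 ^ 2) * Real.sin_sq_add_cos_sq θ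
  rw [hconst] at hcomp
  have h0 := hcomp.unique (hasDerivAt_const 0 (u z))
  have hv : ((-z.2, z.1) : ℝ × ℝ) = -z.2 • (1, 0) + z.1 • (0, 1) := by simp
  rw [hv, map_add, map_smul, map_smul, smul_eq_mul, smul_eq_mul] at h0
  linarith

lemma contDiffOn_fderiv_apply {u : ℝ × ℝ → ℝ} {δ : ℝ} (hu : ContDiffOn ℝ 2 u (disk δ))
    (e : ℝ × ℝ) : ContDiffOn ℝ 1 (fun w => fderiv ℝ u w e) (disk δ) :=
  (hu.fderiv_of_isOpen (isOpen_disk δ) (by norm_num)).clm_apply contDiffOn_const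

lemma differentiableAt_fderiv_apply {u : ℝ × ℝ → ℝ} {δ : ℝ} (hu : ContDiffOn ℝ 2 u (disk δ))
    (e : ℝ × ℝ) {z : ℝ × ℝ} (hz : z ∈ disk δ) :
    DifferentiableAt ℝ (fun w => fderiv ℝ u w e) z :=
  ((contDiffOn_fderiv_apply hu e).differentiableOn (by norm_num)).differentiableAt
    ((isOpen_disk δ).mem_nhds hz)

lemma continuousOn_jet2 {u : ℝ × ℝ → ℝ} {δ : ℝ} (hu : ContDiffOn ℝ 2 u (disk δ)) :
    ContinuousOn (jet2 u) (disk δ) := by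
  have h1 : ∀ e, ContinuousOn (fun w => fderiv ℝ u w e) (disk δ) := fun e =>
    (contDiffOn_fderiv_apply hu e).continuousOn
  have h2 : ∀ e e', ContinuousOn (fun z => fderiv ℝ (fun w => fderiv ℝ u w e) z e') (disk δ) :=
    fun e e' => ((contDiffOn_fderiv_apply hu e).continuousOn_fderiv_of_isOpen
      (isOpen_disk δ) le_rfl).clm_apply continuousOn_const
  refine continuousOn_pi.2 fun i => ?_
  fin_cases i
  · exact continuousOn_fst
  · exact continuousOn_snd
  · exact h1 _
  · exact h1 _
  · exact h2 _ _
  · exact h2 _ _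
  · exact h2 _ _

lemma jet2_two (u : ℝ × ℝ → ℝ) (z : ℝ × ℝ) : jet2 u z 2 = fderiv ℝ u z (1, 0) := rfl

/-- The 2-jet of a radial function along the positive half of the first axis. -/
lemma IsRadial.jet2_eq {u : ℝ × ℝ → ℝ} {δ x : ℝ} (hrad : IsRadial u (disk δ))
    (hu : ContDiffOn ℝ 2 u (disk δ)) (hx : 0 < x) (hxδ : x < δ) :
    jet2 u (x, 0) = ![x, 0, jet2 u (x, 0) 2, 0, jet2 u (x, 0) 4, 0, jet2 u (x, 0) 2 / x] := by
  have hmem := mk_zero_mem_disk hx.le hxδ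
  have hang : (fun z : ℝ × ℝ => z.1 * fderiv ℝ u z (0, 1)) =ᶠ[𝓝 (x, 0)]
      fun z => z.2 * fderiv ℝ u z (1, 0) := by
    filter_upwards [(isOpen_disk δ).mem_nhds hmem] with z hz
    exact hrad.angular_fderiv_eq_zero hz
      ((hu.differentiableOn (by norm_num)).differentiableAt ((isOpen_disk δ).mem_nhds hz))
  have hA := (hasFDerivAt_fst (𝕜 := ℝ) (p := ((x, 0) : ℝ × ℝ))).mul
    (differentiableAt_fderiv_apply hu (0, 1) hmem).hasFDerivAt
  have hB := (hasFDerivAt_snd (𝕜 := ℝ) (p := ((x, 0) : ℝ × ℝ))).mul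
    (differentiableAt_fderiv_apply hu (1, 0) hmem).hasFDerivAt
  have hAB := congrArg (fun L : ℝ × ℝ →L[ℝ] ℝ => L (0, 1))
    (hA.unique (hB.congr_of_eventuallyEq hang))
  have ht : fderiv ℝ (fun w => fderiv ℝ u w (0, 1)) (x, 0) (0, 1)
      = fderiv ℝ u (x, 0) (1, 0) / x := by
    rw [eq_div_iff hx.ne']
    simp at hAB
    linarith
  funext i
  fin_cases i <;>
    simp [jet2, hrad.fderiv_snd_eq_zero hmem, hrad.fderiv_fderiv_mixed_eq_zero hmem, ht]

lemma hasDerivAt_axis {f : ℝ × ℝ → ℝ} {x : ℝ} (hf : DifferentiableAt ℝ f (x, 0)) :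
    HasDerivAt (fun a => f (a, 0)) (fderiv ℝ f (x, 0) (1, 0)) x :=
  hf.hasFDerivAt.comp_hasDerivAt (f := fun a : ℝ => (a, (0 : ℝ))) x
    ((hasDerivAt_id x).prodMk (hasDerivAt_const x 0))

lemma hasDerivAt_jet2_two {u : ℝ × ℝ → ℝ} {δ x : ℝ} (hu : ContDiffOn ℝ 2 u (disk δ))
    (hx : (x, (0 : ℝ)) ∈ disk δ) :
    HasDerivAt (fun a => jet2 u (a, 0) 2) (jet2 u (x, 0) 4) x :=
  hasDerivAt_axis (differentiableAt_fderiv_apply hu (1, 0) hx)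

lemma radial_vec_sub (x p r p' r' : ℝ) :
    (![x, 0, p, 0, r, 0, p / x] - ![x, 0, p', 0, r', 0, p' / x] : Fin 7 → ℝ) =
      (p - p') • Pi.single 2 1 + (r - r') • Pi.single 4 1 + ((p - p') / x) • Pi.single 6 1 := by
  funext i
  fin_cases i <;> simp [sub_div]

/-- The difference of the jets of two radial functions along the first axis. -/
lemma jet2_sub_jet2 {u v : ℝ × ℝ → ℝ} {δ x : ℝ}
    (hurad : IsRadial u (disk δ)) (hvrad : IsRadial v (disk δ))
    (hu : ContDiffOn ℝ 2 u (disk δ)) (hv : ContDiffOn ℝ 2 v (disk δ)) (hx : 0 < x) (hxδ : x < δ) :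
    jet2 v (x, 0) - jet2 u (x, 0) =
      (jet2 v (x, 0) 2 - jet2 u (x, 0) 2) • Pi.single 2 1 +
      (jet2 v (x, 0) 4 - jet2 u (x, 0) 4) • Pi.single 4 1 +
      ((jet2 v (x, 0) 2 - jet2 u (x, 0) 2) / x) • Pi.single 6 1 :=
  (congrArg₂ (· - ·) (hvrad.jet2_eq hv hx hxδ) (hurad.jet2_eq hu hx hxδ)).trans
    (radial_vec_sub x _ _ _ _)

/-- A Grönwall-type uniqueness statement: `w * deriv w ≤ K * w ^ 2` and `w 0 = 0`
force `w = 0`. -/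
lemma eq_zero_of_mul_deriv_le {w w' : ℝ → ℝ} {b K : ℝ} (h0 : w 0 = 0)
    (hw : ∀ x ∈ Icc 0 b, HasDerivAt w (w' x) x)
    (hle : ∀ x ∈ Ioo 0 b, w x * w' x ≤ K * w x ^ 2) {x : ℝ} (hx : x ∈ Icc 0 b) : w x = 0 := by
  have hg : ∀ x ∈ Icc 0 b, HasDerivAt (fun x => w x ^ 2 * Real.exp (-2 * K * x))
      (2 * (w x * w' x - K * w x ^ 2) * Real.exp (-2 * K * x)) x := by
    intro x hx
    have he : HasDerivAt (fun x => Real.exp (-2 * K * x)) (Real.exp (-2 * K * x) * (-2 * K)) x := by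
      simpa using ((hasDerivAt_id x).const_mul (-2 * K)).exp
    refine (((hw x hx).fun_pow 2).mul he).congr_deriv ?_
    simp
    ring
  have hanti : AntitoneOn (fun x => w x ^ 2 * Real.exp (-2 * K * x)) (Icc 0 b) := by
    refine antitoneOn_of_deriv_nonpos (convex_Icc 0 b)
      (fun x hx => (hg x hx).continuousAt.continuousWithinAt)
      (fun x hx => (hg x (interior_subset hx)).differentiableAt.differentiableWithinAt) ?_
    intro x hx
    rw [(hg x (interior_subset hx)).deriv]
    rw [interior_Icc] at hx
    exact mul_nonpos_of_nonpos_of_nonneg (by linarith [hle x hx]) (Real.exp_pos _).le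
  have h := hanti ⟨le_rfl, hx.1.trans hx.2⟩ hx hx.1
  simp only [h0] at h
  have h2 : w x ^ 2 ≤ 0 := by
    by_contra! hc
    have := mul_pos hc (Real.exp_pos (-2 * K * x))
    linarith
  exact (pow_eq_zero_iff two_ne_zero).1 (le_antisymm h2 (sq_nonneg _))

/-- Two radial solutions have the same radial derivative on their common disk. -/
lemma radial_deriv_eq
    {U : Set (Fin 7 → ℝ)} (hUopen : IsOpen U) (hUconv : Convex ℝ U)
    {F : (Fin 7 → ℝ) → ℝ} (hF : ContDiffOn ℝ 1 F U)
    (hr : ∀ P ∈ U, 0 < fderiv ℝ F P (Pi.single 4 1))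
    (ht : ∀ P ∈ U, 0 ≤ fderiv ℝ F P (Pi.single 6 1))
    {δ : ℝ} {u v : ℝ × ℝ → ℝ}
    (hu : ContDiffOn ℝ 2 u (disk δ)) (hv : ContDiffOn ℝ 2 v (disk δ))
    (hurad : IsRadial u (disk δ)) (hvrad : IsRadial v (disk δ))
    (huU : ∀ z ∈ disk δ, jet2 u z ∈ U) (hvU : ∀ z ∈ disk δ, jet2 v z ∈ U)
    (hFuv : ∀ z ∈ disk δ, F (jet2 u z) = F (jet2 v z))
    {x : ℝ} (hx : 0 ≤ x) (hxδ : x < δ) :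
    fderiv ℝ u (x, 0) (1, 0) = fderiv ℝ v (x, 0) (1, 0) := by
  have hmem : ∀ a ∈ Icc 0 x, (a, (0 : ℝ)) ∈ disk δ := fun a ha =>
    mk_zero_mem_disk ha.1 (ha.2.trans_lt hxδ)
  have hdF : ∀ e, ContinuousOn (fun P => fderiv ℝ F P e) U := fun e =>
    (hF.continuousOn_fderiv_of_isOpen hUopen le_rfl).clm_apply continuousOn_const
  set Φ : ℝ × ℝ → Fin 7 → ℝ := fun q =>
    (1 - q.2) • jet2 u (q.1, 0) + q.2 • jet2 v (q.1, 0)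
  have hΦcont : ContinuousOn Φ (Icc 0 x ×ˢ Icc 0 1) := by
    have haxis : ∀ {f : ℝ × ℝ → ℝ}, ContDiffOn ℝ 2 f (disk δ) →
        ContinuousOn (fun q : ℝ × ℝ => jet2 f (q.1, 0)) (Icc 0 x ×ˢ Icc 0 1) := fun hf =>
      (continuousOn_jet2 hf).comp (f := fun q : ℝ × ℝ => (q.1, (0 : ℝ))) (by fun_prop)
        fun q hq => hmem q.1 hq.1
    exact ((by fun_prop : ContinuousOn (fun q : ℝ × ℝ => 1 - q.2) _).smul (haxis hu)).add
      (continuousOn_snd.smul (haxis hv))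
  have hΦU : MapsTo Φ (Icc 0 x ×ˢ Icc 0 1) U := fun q hq =>
    hUconv (huU _ (hmem _ hq.1)) (hvU _ (hmem _ hq.1)) (by linarith [hq.2.2]) hq.2.1 (by ring)
  obtain ⟨K, hK⟩ := (isCompact_Icc.prod isCompact_Icc).exists_bound_of_continuousOn
    ((((hdF (Pi.single 2 1)).div (hdF (Pi.single 4 1))
      fun P hP => (hr P hP).ne').comp hΦcont hΦU))
  have hδ : 0 < δ := hx.trans_lt hxδ
  have h0 : jet2 v (0, 0) 2 - jet2 u (0, 0) 2 = 0 := by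
    rw [jet2_two, jet2_two, hurad.fderiv_zero_eq_zero hδ, hvrad.fderiv_zero_eq_zero hδ, sub_self]
  have hw : ∀ a ∈ Icc 0 x, HasDerivAt (fun a => jet2 v (a, 0) 2 - jet2 u (a, 0) 2)
      (jet2 v (a, 0) 4 - jet2 u (a, 0) 4) a := fun a ha =>
    (hasDerivAt_jet2_two hv (hmem a ha)).fun_sub (hasDerivAt_jet2_two hu (hmem a ha))
  rw [← jet2_two, ← jet2_two]
  refine (sub_eq_zero.1 (eq_zero_of_mul_deriv_le (K := K) h0 hw ?_ ⟨hx, le_rfl⟩)).symm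
  intro a ha
  have haI : a ∈ Icc 0 x := Ioo_subset_Icc_self ha
  have hm := hmem a haI
  obtain ⟨R, hR, hmvt⟩ := domain_mvt (f := F) (f' := fderiv ℝ F)
    (fun P hP => ((hF.differentiableOn one_ne_zero).differentiableAt
      (hUopen.mem_nhds hP)).hasFDerivAt.hasFDerivWithinAt) hUconv (huU _ hm) (hvU _ hm)
  have hRU : R ∈ U := hUconv.segment_subset (huU _ hm) (hvU _ hm) hR
  rw [segment_eq_image] at hR
  obtain ⟨θ, hθ, hθR⟩ := hR
  have hb := hK (a, θ) ⟨haI, hθ⟩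
  have hΦR : Φ (a, θ) = R := hθR
  simp only [Function.comp, hΦR, Pi.div_apply, Real.norm_eq_abs] at hb
  rw [hFuv _ hm, sub_self, jet2_sub_jet2 hurad hvrad hu hv ha.1 (ha.2.trans hxδ)] at hmvt
  simp only [map_add, map_smul, smul_eq_mul] at hmvt
  generalize jet2 v (a, 0) 2 - jet2 u (a, 0) 2 = p at *
  generalize jet2 v (a, 0) 4 - jet2 u (a, 0) 4 = r at *
  have hA := hr R hRU
  have hC := ht R hRU
  generalize fderiv ℝ F R (Pi.single 2 1) = B at *
  generalize fderiv ℝ F R (Pi.single 4 1) = A at *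
  generalize fderiv ℝ F R (Pi.single 6 1) = C at *
  rw [abs_div, abs_of_pos hA, div_le_iff₀ hA] at hb
  have hCp : 0 ≤ C * (p ^ 2 / a) := mul_nonneg hC (div_nonneg (sq_nonneg p) ha.1.le)
  have hBp : -B * p ^ 2 ≤ K * A * p ^ 2 :=
    mul_le_mul_of_nonneg_right ((neg_le_abs B).trans hb) (sq_nonneg p)
  have hsum : A * (p * r) = -B * p ^ 2 - C * (p ^ 2 / a) := by
    linear_combination -p * hmvt
  refine le_of_mul_le_mul_left ?_ hA
  linarith

/-- Uniqueness, up to additive constants, of radial solutions of a rotationally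
invariant fully nonlinear elliptic PDE `F(x, y, u_x, u_y, u_xx, u_xy, u_yy) = 0`. -/
theorem radial_solution_unique
    (U : Set (Fin 7 → ℝ)) (hUopen : IsOpen U) (hUconv : Convex ℝ U)
    (F : (Fin 7 → ℝ) → ℝ) (hF : ContDiffOn ℝ 3 F U)
    (hell : ∀ P ∈ U,
      0 < fderiv ℝ F P (Pi.single 4 1) ∧
      0 < 4 * fderiv ℝ F P (Pi.single 4 1) * fderiv ℝ F P (Pi.single 6 1)
          - (fderiv ℝ F P (Pi.single 5 1)) ^ 2)
    (α : ℝ) (hα_mem : (![0, 0, 0, 0, α, 0, α] : Fin 7 → ℝ) ∈ U)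
    (hα_zero : F ![0, 0, 0, 0, α, 0, α] = 0)
    (hrot : RotInvariant F U)
    (δ δ' : ℝ) (hδ : 0 < δ) (hδ' : 0 < δ')
    (u v : ℝ × ℝ → ℝ)
    (hu : ContDiffOn ℝ 2 u (disk δ)) (hv : ContDiffOn ℝ 2 v (disk δ'))
    (hurad : IsRadial u (disk δ)) (hvrad : IsRadial v (disk δ'))
    (huU : ∀ z ∈ disk δ, jet2 u z ∈ U) (hvU : ∀ z ∈ disk δ', jet2 v z ∈ U)
    (huF : ∀ z ∈ disk δ, F (jet2 u z) = 0) (hvF : ∀ z ∈ disk δ', F (jet2 v z) = 0) :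
    ∃ c : ℝ, ∀ z ∈ disk (min δ δ'), v z = u z + c := by
  set ε := min δ δ'
  have hεpos : 0 < ε := lt_min hδ hδ'
  have hsub : ∀ {η : ℝ}, ε ≤ η → disk ε ⊆ disk η := fun h z hz =>
    lt_of_lt_of_le (show z.1 ^ 2 + z.2 ^ 2 < ε ^ 2 from hz) (pow_le_pow_left₀ hεpos.le h 2)
  have hsu := hsub (min_le_left δ δ')
  have hsv := hsub (min_le_right δ δ')
  have hp : ∀ x, 0 ≤ x → x < ε → fderiv ℝ u (x, 0) (1, 0) = fderiv ℝ v (x, 0) (1, 0) :=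
    fun x hx hxε => radial_deriv_eq hUopen hUconv (hF.of_le (by norm_num))
      (fun P hP => (hell P hP).1)
      (fun P hP => by
        obtain ⟨h1, h2⟩ := hell P hP
        by_contra! hneg
        nlinarith [mul_pos_of_neg_of_neg hneg (neg_lt_zero.2 h1),
          sq_nonneg (fderiv ℝ F P (Pi.single 5 1))])
      (hu.mono hsu) (hv.mono hsv)
      (hurad.imp fun g hg z hz => hg z (hsu hz)) (hvrad.imp fun g hg z hz => hg z (hsv hz))
      (fun z hz => huU z (hsu hz)) (fun z hz => hvU z (hsv hz))
      (fun z hz => (huF z (hsu hz)).trans (hvF z (hsv hz)).symm) hx hxε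
  refine ⟨v (0, 0) - u (0, 0), fun z hz => ?_⟩
  set ρ := Real.sqrt (z.1 ^ 2 + z.2 ^ 2)
  have hρsq : ρ ^ 2 = z.1 ^ 2 + z.2 ^ 2 := Real.sq_sqrt (by positivity)
  have hρε : ρ < ε := (Real.sqrt_lt' hεpos).2 hz
  have hderiv : ∀ a ∈ Icc 0 ρ, HasDerivAt (fun a => v (a, 0) - u (a, 0)) 0 a := by
    intro a ha
    have haε : a < ε := ha.2.trans_lt hρε
    have hm := mk_zero_mem_disk ha.1 haε
    have hdu := hasDerivAt_axis ((hu.differentiableOn (by norm_num)).differentiableAt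
      ((isOpen_disk δ).mem_nhds (hsu hm)))
    have hdv := hasDerivAt_axis ((hv.differentiableOn (by norm_num)).differentiableAt
      ((isOpen_disk δ').mem_nhds (hsv hm)))
    simpa [hp a ha.1 haε] using hdv.fun_sub hdu
  have hconst := constant_of_has_deriv_right_zero
    (fun a ha => (hderiv a ha).continuousAt.continuousWithinAt)
    (fun a ha => (hderiv a (Ico_subset_Icc_self ha)).hasDerivWithinAt)
    ρ ⟨Real.sqrt_nonneg _, le_rfl⟩
  have hu' := hurad.comp_eq (w := (ρ, 0)) (hsu hz) (by simp [hρsq])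
  have hv' := hvrad.comp_eq (w := (ρ, 0)) (hsv hz) (by simp [hρsq])
  simp only [hu', hv'] at hconst
  linarith
end

section
/- Fix real numbers κ, τ and δ > 0 such that 4+κρ² > 0 for all ρ ∈ [0,δ). Let u : [0,δ) → ℝ be C^∞ with u(0) = 0 and u'(0) = 0, and let W : ℝ²×[0,1] → ℝ be C^∞ with W(k₁,k₂,v) = W(k₂,k₁,v) for all (k₁,k₂,v) and (∂W/∂k₁)(∂W/∂k₂) > 0 at every point where W = 0. Assume that for every ρ ∈ (0,δ) one has H(ρ)² ≥ K_e(ρ) and W( H(ρ)+√(H(ρ)²−K_e(ρ)), H(ρ)−√(H(ρ)²−K_e(ρ)), ν(ρ)² ) = 0, where ν, H, K_e are associated to u as in the context. If τ = 0, assume moreover that u is not identically zero. Then: (1) ν is strictly decreasing on [0,δ) (note ν(0)=1); and (2) if τ = 0, then u'(ρ) ≠ 0 for every ρ ∈ (0,δ). -/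
open Set Filter Topology

/-- First (one-sided) derivative on `[0,∞)`. -/
noncomputable def d1 (u : ℝ → ℝ) : ℝ → ℝ := derivWithin u (Set.Ici 0)

/-- Second (one-sided) derivative on `[0,∞)`. -/
noncomputable def d2 (u : ℝ → ℝ) : ℝ → ℝ := derivWithin (derivWithin u (Set.Ici 0)) (Set.Ici 0)

/-- `D(ρ) = u'(ρ)²(4+κρ²)² + 16(1+τ²ρ²)`. -/
noncomputable def Dfun (κ τ : ℝ) (u : ℝ → ℝ) (ρ : ℝ) : ℝ :=
  (d1 u ρ) ^ 2 * (4 + κ * ρ ^ 2) ^ 2 + 16 * (1 + τ ^ 2 * ρ ^ 2)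

/-- The angle function `ν(ρ) = 4/√(D(ρ))` of the rotational graph `x₃ = u(√(x₁²+x₂²))`
in the coordinate model of `E³(κ,τ)`. -/
noncomputable def angleFn (κ τ : ℝ) (u : ℝ → ℝ) (ρ : ℝ) : ℝ :=
  4 / Real.sqrt (Dfun κ τ u ρ)

/-- The mean curvature `H(ρ)` of the rotational graph `x₃ = u(√(x₁²+x₂²))`. -/
noncomputable def meanCurv (κ τ : ℝ) (u : ℝ → ℝ) (ρ : ℝ) : ℝ :=
  (4 + κ * ρ ^ 2) ^ 2 *
      (-κ ^ 2 * ρ ^ 4 * (d1 u ρ) ^ 3 + 16 * d1 u ρ * ((d1 u ρ) ^ 2 + 1)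
        + 16 * ρ * (1 + τ ^ 2 * ρ ^ 2) * d2 u ρ)
    / (8 * ρ * Real.sqrt (Dfun κ τ u ρ) ^ 3)

/-- The extrinsic curvature `K_e(ρ)` of the rotational graph `x₃ = u(√(x₁²+x₂²))`. -/
noncomputable def extCurv (κ τ : ℝ) (u : ℝ → ℝ) (ρ : ℝ) : ℝ :=
  d1 u ρ * (4 + κ * ρ ^ 2) ^ 2 * (4 - (κ - 8 * τ ^ 2) * ρ ^ 2) *
      (d2 u ρ * (4 + κ * ρ ^ 2) + 2 * ρ * (κ - 4 * τ ^ 2) * d1 u ρ)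
    / (ρ * (Dfun κ τ u ρ) ^ 2)
  - τ ^ 2 * ((d1 u ρ) ^ 2 * (4 + κ * ρ ^ 2) ^ 2 + 4 * ρ ^ 2 * (κ - 4 * τ ^ 2)) ^ 2
    / (Dfun κ τ u ρ) ^ 2


/-- The rescaled slope `q = u'(4+κρ²)`. -/
noncomputable def scaledSlope (κ : ℝ) (u : ℝ → ℝ) (ρ : ℝ) : ℝ := d1 u ρ * (4 + κ * ρ ^ 2)

/-- The derivative of the rescaled slope. -/
noncomputable def scaledSlopeDeriv (κ : ℝ) (u : ℝ → ℝ) (ρ : ℝ) : ℝ :=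
  d2 u ρ * (4 + κ * ρ ^ 2) + d1 u ρ * (2 * κ * ρ)

/-- The derivative of `Dfun`. -/
noncomputable def DfunDeriv (κ τ : ℝ) (u : ℝ → ℝ) (ρ : ℝ) : ℝ :=
  2 * scaledSlope κ u ρ * scaledSlopeDeriv κ u ρ + 32 * τ ^ 2 * ρ

lemma Dfun_eq (κ τ : ℝ) (u : ℝ → ℝ) (ρ : ℝ) :
    Dfun κ τ u ρ = scaledSlope κ u ρ ^ 2 + 16 * (1 + τ ^ 2 * ρ ^ 2) := by
  unfold Dfun scaledSlope
  ring

lemma sixteen_le_Dfun (κ τ : ℝ) (u : ℝ → ℝ) (ρ : ℝ) : 16 ≤ Dfun κ τ u ρ := by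
  rw [Dfun_eq]
  have h : 0 ≤ τ ^ 2 * ρ ^ 2 := by positivity
  nlinarith [sq_nonneg (scaledSlope κ u ρ)]

lemma Dfun_pos (κ τ : ℝ) (u : ℝ → ℝ) (ρ : ℝ) : 0 < Dfun κ τ u ρ :=
  lt_of_lt_of_le (by norm_num) (sixteen_le_Dfun κ τ u ρ)

lemma angleFn_sq (κ τ : ℝ) (u : ℝ → ℝ) (ρ : ℝ) :
    angleFn κ τ u ρ ^ 2 = 16 / Dfun κ τ u ρ := by
  unfold angleFn
  rw [div_pow, Real.sq_sqrt (Dfun_pos κ τ u ρ).le]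
  norm_num

lemma extCurv_eq (κ τ : ℝ) (u : ℝ → ℝ) {ρ : ℝ} (hρ : ρ ≠ 0) :
    extCurv κ τ u ρ = -τ ^ 2 + (4 - (κ - 8 * τ ^ 2) * ρ ^ 2) * (4 + κ * ρ ^ 2)
      * DfunDeriv κ τ u ρ / (2 * ρ * Dfun κ τ u ρ ^ 2) := by
  have hD := (Dfun_pos κ τ u ρ).ne'
  unfold extCurv
  field_simp
  unfold DfunDeriv Dfun scaledSlope scaledSlopeDeriv
  ring

lemma meanCurv_eq (κ τ : ℝ) (u : ℝ → ℝ) {ρ : ℝ} (hρ : ρ ≠ 0) (hq : scaledSlope κ u ρ ≠ 0) :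
    meanCurv κ τ u ρ = (8 * scaledSlope κ u ρ ^ 2 - (Dfun κ τ u ρ - 16) * (4 + κ * ρ ^ 2)
        + 8 * (1 + τ ^ 2 * ρ ^ 2) * (4 + κ * ρ ^ 2) * ρ * DfunDeriv κ τ u ρ / Dfun κ τ u ρ)
      / (8 * ρ * scaledSlope κ u ρ * √(Dfun κ τ u ρ)) := by
  have hD := Dfun_pos κ τ u ρ
  have hR : √(Dfun κ τ u ρ) ≠ 0 := (Real.sqrt_pos.2 hD).ne'
  have hR2 : √(Dfun κ τ u ρ) ^ 2 = Dfun κ τ u ρ := Real.sq_sqrt hD.le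
  have hR3 : √(Dfun κ τ u ρ) ^ 3 = Dfun κ τ u ρ * √(Dfun κ τ u ρ) := by rw [pow_succ, hR2]
  have hD' := hD.ne'
  unfold meanCurv
  rw [hR3]
  field_simp
  unfold DfunDeriv Dfun scaledSlope scaledSlopeDeriv
  ring

/-! ### Regularity -/

lemma Ico_eventuallyEq_Ici {δ x : ℝ} (hx : x ∈ Ico (0 : ℝ) δ) :
    (Ico (0 : ℝ) δ : Set ℝ) =ᶠ[𝓝 x] Ici 0 := by
  filter_upwards [Iio_mem_nhds hx.2] with y hy
  have hy' : y < δ := hy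
  apply propext
  constructor
  · intro h
    exact h.1
  · intro h
    exact ⟨h, hy'⟩

lemma contDiffOn_d1 {f : ℝ → ℝ} {δ : ℝ} (hf : ContDiffOn ℝ (⊤ : ℕ∞) f (Ico 0 δ)) :
    ContDiffOn ℝ (⊤ : ℕ∞) (d1 f) (Ico 0 δ) := by
  have h : ContDiffOn ℝ (⊤ : ℕ∞) (derivWithin f (Ico 0 δ)) (Ico 0 δ) :=
    hf.derivWithin (uniqueDiffOn_Ico 0 δ) (by simp)
  refine h.congr fun x hx => ?_
  exact (derivWithin_congr_set (Ico_eventuallyEq_Ici hx)).symm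

lemma hasDerivWithinAt_d1 {f : ℝ → ℝ} {δ x : ℝ} (hf : ContDiffOn ℝ (⊤ : ℕ∞) f (Ico 0 δ))
    (hx : x ∈ Ico (0 : ℝ) δ) : HasDerivWithinAt f (d1 f x) (Ici 0) x := by
  have h := (hf.differentiableOn (by simp) x hx).hasDerivWithinAt
  rw [hasDerivWithinAt_congr_set (Ico_eventuallyEq_Ici hx)] at h
  exact h.differentiableWithinAt.hasDerivWithinAt

lemma contDiffOn_four_add (κ : ℝ) (s : Set ℝ) :
    ContDiffOn ℝ (⊤ : ℕ∞) (fun ρ : ℝ => 4 + κ * ρ ^ 2) s := by fun_prop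

lemma contDiffOn_scaledSlope {κ δ : ℝ} {u : ℝ → ℝ} (hu : ContDiffOn ℝ (⊤ : ℕ∞) u (Ico 0 δ)) :
    ContDiffOn ℝ (⊤ : ℕ∞) (scaledSlope κ u) (Ico 0 δ) :=
  (contDiffOn_d1 hu).mul (contDiffOn_four_add κ _)

lemma contDiffOn_scaledSlopeDeriv {κ δ : ℝ} {u : ℝ → ℝ}
    (hu : ContDiffOn ℝ (⊤ : ℕ∞) u (Ico 0 δ)) :
    ContDiffOn ℝ (⊤ : ℕ∞) (scaledSlopeDeriv κ u) (Ico 0 δ) :=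
  ((contDiffOn_d1 (contDiffOn_d1 hu)).mul (contDiffOn_four_add κ _)).add
    ((contDiffOn_d1 hu).mul (by fun_prop))

lemma hasDerivWithinAt_scaledSlope {κ δ x : ℝ} {u : ℝ → ℝ}
    (hu : ContDiffOn ℝ (⊤ : ℕ∞) u (Ico 0 δ)) (hx : x ∈ Ico (0 : ℝ) δ) :
    HasDerivWithinAt (scaledSlope κ u) (scaledSlopeDeriv κ u x) (Ici 0) x := by
  have h1 : HasDerivWithinAt (d1 u) (d2 u x) (Ici 0) x :=
    hasDerivWithinAt_d1 (contDiffOn_d1 hu) hx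
  have h2 : HasDerivWithinAt (fun ρ : ℝ => 4 + κ * ρ ^ 2) (2 * κ * x) (Ici 0) x := by
    have := (((hasDerivAt_id x).pow 2).const_mul κ).const_add 4
    refine (this.congr_deriv ?_).hasDerivWithinAt
    simp
    ring
  exact h1.mul h2

lemma contDiffOn_DfunDeriv {κ τ δ : ℝ} {u : ℝ → ℝ} (hu : ContDiffOn ℝ (⊤ : ℕ∞) u (Ico 0 δ)) :
    ContDiffOn ℝ (⊤ : ℕ∞) (DfunDeriv κ τ u) (Ico 0 δ) :=
  ((contDiffOn_const.mul (contDiffOn_scaledSlope hu)).mul (contDiffOn_scaledSlopeDeriv hu)).add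
    (by fun_prop)

lemma hasDerivWithinAt_Dfun {κ τ δ x : ℝ} {u : ℝ → ℝ}
    (hu : ContDiffOn ℝ (⊤ : ℕ∞) u (Ico 0 δ)) (hx : x ∈ Ico (0 : ℝ) δ) :
    HasDerivWithinAt (Dfun κ τ u) (DfunDeriv κ τ u x) (Ici 0) x := by
  have h1 := (hasDerivWithinAt_scaledSlope (κ := κ) hu hx).pow 2
  have h2 : HasDerivWithinAt (fun ρ : ℝ => 16 * (1 + τ ^ 2 * ρ ^ 2)) (32 * τ ^ 2 * x)
      (Ici 0) x := by
    have := ((((hasDerivAt_id x).pow 2).const_mul (τ ^ 2)).const_add 1).const_mul 16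
    refine (this.congr_deriv ?_).hasDerivWithinAt
    simp
    ring
  have h3 := h1.add h2
  have h4 : (scaledSlope κ u ^ 2 + fun ρ : ℝ => 16 * (1 + τ ^ 2 * ρ ^ 2)) = Dfun κ τ u := by
    funext ρ
    simp [Dfun_eq]
  rw [h4] at h3
  refine h3.congr_deriv ?_
  unfold DfunDeriv
  simp

/-! ### One-variable calculus -/

lemma HasDerivWithinAt.eventually_pos {f : ℝ → ℝ} {c a : ℝ} (hf : HasDerivWithinAt f c (Ici a) a)
    (ha : f a = 0) (hc : 0 < c) : ∀ᶠ x in 𝓝[>] a, 0 < f x := by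
  have h := hasDerivWithinAt_iff_tendsto_slope.1 (hf.mono Ioi_subset_Ici_self)
  have hs : Ioi a \ {a} = Ioi a := by simp
  rw [hs] at h
  filter_upwards [h.eventually (lt_mem_nhds hc), self_mem_nhdsWithin] with x hx hxa
  have hxa' : 0 < x - a := sub_pos.2 hxa
  rw [slope_def_field, ha, sub_zero] at hx
  exact (div_pos_iff_of_pos_right hxa').1 hx

lemma HasDerivAt.nonpos_of_pos_left {f : ℝ → ℝ} {c a b : ℝ} (hf : HasDerivAt f c b) (hab : a < b)
    (hb : f b = 0) (hpos : ∀ x ∈ Ico a b, 0 < f x) : c ≤ 0 := by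
  have h := hasDerivWithinAt_iff_tendsto_slope.1 (hf.hasDerivWithinAt (s := Iio b))
  have hs : Iio b \ {b} = Iio b := by simp
  rw [hs] at h
  refine le_of_tendsto h ?_
  filter_upwards [Ico_mem_nhdsLT hab] with x hx
  rw [slope_def_field, hb, sub_zero]
  exact div_nonpos_of_nonneg_of_nonpos (hpos x hx).le (by linarith [hx.2])

lemma exists_first_zero {f : ℝ → ℝ} {a b : ℝ} (hab : a ≤ b) (hf : ContinuousOn f (Icc a b))
    (ha : 0 < f a) (hb : f b ≤ 0) :
    ∃ c ∈ Ioc a b, f c = 0 ∧ ∀ x ∈ Ico a c, 0 < f x := by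
  set S := Icc a b ∩ f ⁻¹' Iic 0 with hS
  have hcl : IsClosed S := hf.preimage_isClosed_of_isClosed isClosed_Icc isClosed_Iic
  have hne : S.Nonempty := ⟨b, ⟨hab, le_rfl⟩, hb⟩
  have hbd : BddBelow S := ⟨a, fun x hx => hx.1.1⟩
  have hc : sInf S ∈ S := hcl.csInf_mem hne hbd
  have hpos : ∀ x ∈ Ico a (sInf S), 0 < f x := by
    intro x hx
    by_contra hneg
    have : x ∈ S := ⟨⟨hx.1, hx.2.le.trans hc.1.2⟩, not_lt.1 hneg⟩
    exact absurd (csInf_le hbd this) (not_le.2 hx.2)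
  have hfc : f (sInf S) ≤ 0 := hc.2
  have hac : a < sInf S := by
    refine lt_of_le_of_ne hc.1.1 fun h => ?_
    rw [← h] at hfc
    linarith
  refine ⟨sInf S, ⟨hac, hc.1.2⟩, le_antisymm hfc ?_, hpos⟩
  have ht : Tendsto f (𝓝[Ico a (sInf S)] (sInf S)) (𝓝 (f (sInf S))) :=
    (hf _ hc.1).mono_left (nhdsWithin_mono _ fun x hx => ⟨hx.1, hx.2.le.trans hc.1.2⟩)
  have : (𝓝[Ico a (sInf S)] (sInf S)).NeBot := by
    rw [nhdsWithin_Ico_eq_nhdsLT hac]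
    infer_instance
  exact ge_of_tendsto ht (eventually_mem_nhdsWithin.mono fun x hx => (hpos x hx).le)

/-! ### First-order information on the Weingarten function -/

/-- The domain `ℝ² × [0,1]` of the Weingarten function. -/
def weingartenDomain : Set (ℝ × ℝ × ℝ) := Set.univ ×ˢ Set.univ ×ˢ Set.Icc 0 1

lemma mem_weingartenDomain {a b v : ℝ} : (a, b, v) ∈ weingartenDomain ↔ v ∈ Icc (0 : ℝ) 1 := by
  simp [weingartenDomain]

lemma fderivWithin_weingarten_apply {W : ℝ × ℝ × ℝ → ℝ} {L : ℝ × ℝ × ℝ →L[ℝ] ℝ} {k₁ k₂ v : ℝ}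
    (hL : HasFDerivWithinAt W L weingartenDomain (k₁, k₂, v)) (hv : v ∈ Icc (0 : ℝ) 1)
    (a b c : ℝ) : L (a, b, c) = deriv (fun x => W (x, k₂, v)) k₁ * a
      + deriv (fun y => W (k₁, y, v)) k₂ * b + L (0, 0, 1) * c := by
  have h1 : HasDerivAt (fun x => W (x, k₂, v)) (L (1, 0, 0)) k₁ :=
    hL.comp_hasDerivAt k₁ ((hasDerivAt_id k₁).prodMk
      ((hasDerivAt_const k₁ k₂).prodMk (hasDerivAt_const k₁ v)))
      (Eventually.of_forall fun x => mem_weingartenDomain.2 hv)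
  have h2 : HasDerivAt (fun y => W (k₁, y, v)) (L (0, 1, 0)) k₂ :=
    hL.comp_hasDerivAt k₂ ((hasDerivAt_const k₂ k₁).prodMk
      ((hasDerivAt_id k₂).prodMk (hasDerivAt_const k₂ v)))
      (Eventually.of_forall fun x => mem_weingartenDomain.2 hv)
  have h3 : ((a, b, c) : ℝ × ℝ × ℝ) = a • ((1, 0, 0) : ℝ × ℝ × ℝ)
      + b • ((0, 1, 0) : ℝ × ℝ × ℝ) + c • ((0, 0, 1) : ℝ × ℝ × ℝ) := by
    simp
  rw [h1.deriv, h2.deriv, h3, map_add, map_add, map_smul, map_smul, map_smul]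
  simp only [smul_eq_mul]
  ring

lemma mul_deriv_neg_of_weingarten {W : ℝ × ℝ × ℝ → ℝ}
    (hW : DifferentiableOn ℝ W weingartenDomain)
    (hWell : ∀ k₁ k₂ : ℝ, ∀ v ∈ Set.Icc (0 : ℝ) 1, W (k₁, k₂, v) = 0 →
      0 < deriv (fun x => W (x, k₂, v)) k₁ * deriv (fun y => W (k₁, y, v)) k₂)
    {a b v : ℝ → ℝ} {a' b' x : ℝ} (ha : HasDerivAt a a' x) (hb : HasDerivAt b b' x)
    (hv : HasDerivAt v 0 x) (hv01 : ∀ y, v y ∈ Icc (0 : ℝ) 1)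
    (h0 : ∀ᶠ y in 𝓝 x, W (a y, b y, v y) = 0) (hb' : b' ≠ 0) : a' * b' < 0 := by
  have hL := (hW (a x, b x, v x) (mem_weingartenDomain.2 (hv01 x))).hasFDerivWithinAt
  have hell := hWell (a x) (b x) (v x) (hv01 x) h0.self_of_nhds
  have hlin := fderivWithin_weingarten_apply hL (hv01 x) a' b' 0
  have hd := hL.comp_hasDerivAt x (ha.prodMk (hb.prodMk hv))
    (Eventually.of_forall fun y => mem_weingartenDomain.2 (hv01 y))
  have hz : HasDerivAt (W ∘ fun y => (a y, b y, v y)) 0 x :=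
    (hasDerivAt_const x (0 : ℝ)).congr_of_eventuallyEq h0
  rw [hd.unique hz] at hlin
  set p := deriv (fun y => W (y, b x, v x)) (a x)
  set q := deriv (fun y => W (a x, y, v x)) (b x)
  have hq : q ≠ 0 := by
    intro h
    simp [h] at hell
  have h1 : p * q * (a' * b') = -(q * b') ^ 2 := by linear_combination (-q * b') * hlin
  have h2 : 0 < (q * b') ^ 2 := by positivity
  by_contra hneg
  nlinarith [mul_nonneg hell.le (not_lt.1 hneg)]

lemma mul_le_of_abs_linear_le {a b c ε t s w : ℝ} (hab : 0 < a * b) (hεa : ε ≤ |a| / 2)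
    (hε : 0 ≤ ε) (hεb : ε ≤ |b| / 2)
    (h : |a * t + b * s + c * w| ≤ ε * (|t| + |s| + |w|)) (q : ℝ) :
    q * t ≤ 2 / |a| * (|b| + |c| + 2 * ε) * (max 0 (-(q * s)) + |q| * |w|) := by
  wlog ha : 0 < a generalizing a b c
  · have ha0 : a ≠ 0 := by
      rintro rfl
      simp at hab
    have ha' : 0 < -a := by
      rcases lt_or_gt_of_ne ha0 with h1 | h1
      · linarith
      · exact absurd h1 ha
    have := this (a := -a) (b := -b) (c := -c) (by linarith) (by rwa [abs_neg]) (by rwa [abs_neg])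
      (by rwa [show -a * t + -b * s + -c * w = -(a * t + b * s + c * w) by ring, abs_neg]) ha'
    simpa only [abs_neg] using this
  have hb : 0 < b := (pos_iff_pos_of_mul_pos hab).1 ha
  rw [abs_of_pos ha] at hεa ⊢
  rw [abs_of_pos hb] at hεb ⊢
  set n := max 0 (-(q * s)) with hn
  have hn0 : 0 ≤ n := le_max_left _ _
  have hns : -(q * s) ≤ n := le_max_right _ _
  have hqw : 0 ≤ |q| * |w| := by positivity
  rcases le_or_gt (q * t) 0 with hqt | hqt
  · exact hqt.trans (by positivity)
  have hmul : q * (a * t + b * s + c * w) ≤ ε * (|q * t| + |q * s| + |q| * |w|) := by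
    calc q * (a * t + b * s + c * w) ≤ |q| * |a * t + b * s + c * w| := by
          rw [← abs_mul]; exact le_abs_self _
      _ ≤ |q| * (ε * (|t| + |s| + |w|)) := by gcongr
      _ = _ := by rw [abs_mul, abs_mul]; ring
  rw [abs_of_pos hqt] at hmul
  have hcw : -(c * (q * w)) ≤ |c| * (|q| * |w|) := by
    rw [← abs_mul, ← abs_mul]
    exact neg_le_abs _
  have hs : -b * (q * s) + ε * |q * s| ≤ (b + ε) * n := by
    rcases le_or_gt 0 (q * s) with h1 | h1
    · rw [abs_of_nonneg h1]
      have : 0 ≤ (b + ε) * n := by positivity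
      nlinarith
    · rw [abs_of_neg h1]
      nlinarith
  have key : a / 2 * (q * t) ≤ (b + |c| + 2 * ε) * (n + |q| * |w|) := by
    have e1 : 0 ≤ |c| * n := by positivity
    have e2 : 0 ≤ b * (|q| * |w|) := by positivity
    have e3 : 0 ≤ ε * n := by positivity
    have e4 : 0 ≤ ε * (|q| * |w|) := by positivity
    have e5 : ε * (q * t) ≤ a / 2 * (q * t) := by gcongr
    nlinarith
  calc q * t = 2 / a * (a / 2 * (q * t)) := by field_simp
    _ ≤ 2 / a * ((b + |c| + 2 * ε) * (n + |q| * |w|)) := by gcongr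
    _ = _ := by ring

lemma exists_eventually_mul_le_of_weingarten {W : ℝ × ℝ × ℝ → ℝ}
    (hW : DifferentiableOn ℝ W weingartenDomain)
    (hWell : ∀ k₁ k₂ : ℝ, ∀ v ∈ Set.Icc (0 : ℝ) 1, W (k₁, k₂, v) = 0 →
      0 < deriv (fun x => W (x, k₂, v)) k₁ * deriv (fun y => W (k₁, y, v)) k₂)
    (h0 : W (0, 0, 1) = 0) :
    ∃ C : ℝ, 0 ≤ C ∧ ∀ᶠ z in 𝓝[weingartenDomain] ((0, 0, 1) : ℝ × ℝ × ℝ), W z = 0 →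
      ∀ q : ℝ, q * z.1 ≤ C * (max 0 (-(q * z.2.1)) + |q| * |z.2.2 - 1|) := by
  have h1 : (1 : ℝ) ∈ Icc (0 : ℝ) 1 := ⟨zero_le_one, le_rfl⟩
  have hL := (hW (0, 0, 1) (mem_weingartenDomain.2 h1)).hasFDerivWithinAt
  have hell := hWell 0 0 1 h1 h0
  have hlin := fderivWithin_weingarten_apply hL h1
  set L := fderivWithin ℝ W weingartenDomain (0, 0, 1)
  set a := deriv (fun x => W (x, 0, 1)) 0
  set b := deriv (fun y => W (0, y, 1)) 0
  have ha : a ≠ 0 := by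
    intro h
    simp [h] at hell
  have hb : b ≠ 0 := by
    intro h
    simp [h] at hell
  have hε : 0 < min (|a| / 2) (|b| / 2) := by positivity
  set ε := min (|a| / 2) (|b| / 2)
  refine ⟨2 / |a| * (|b| + |L (0, 0, 1)| + 2 * ε), by positivity, ?_⟩
  filter_upwards [hL.isLittleO.def hε] with z hz hWz q
  obtain ⟨t, s, w⟩ := z
  refine mul_le_of_abs_linear_le hell (min_le_left _ _) hε.le (min_le_right _ _) ?_ q
  rw [hWz, h0] at hz
  rw [Prod.mk_sub_mk, Prod.mk_sub_mk, sub_zero, sub_zero, sub_zero, hlin t s (w - 1), zero_sub,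
    norm_neg, Real.norm_eq_abs] at hz
  refine hz.trans ?_
  gcongr
  simp only [Prod.norm_def, Real.norm_eq_abs]
  have h1 := abs_nonneg t
  have h2 := abs_nonneg s
  have h3 := abs_nonneg (w - 1)
  exact max_le (by linarith) (max_le (by linarith) (by linarith))

/-! ### Critical points of the angle function -/

lemma hasDerivAt_meanCurv_formula {q D D₁ : ℝ → ℝ} {κ τ x q₁ D₂ : ℝ} (hq : HasDerivAt q q₁ x)
    (hD : HasDerivAt D 0 x) (hD₁ : HasDerivAt D₁ D₂ x) (h0 : D₁ x = 0)
    (hDx : D x = q x ^ 2 + 16 * (1 + τ ^ 2 * x ^ 2)) (hqq : q x * q₁ = -(16 * τ ^ 2 * x))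
    (hx : x ≠ 0) (hqx : q x ≠ 0) :
    HasDerivAt (fun y => (8 * q y ^ 2 - (D y - 16) * (4 + κ * y ^ 2)
        + 8 * (1 + τ ^ 2 * y ^ 2) * (4 + κ * y ^ 2) * y * D₁ y / D y) / (8 * y * q y * √(D y)))
      ((1 + τ ^ 2 * x ^ 2) * (4 + κ * x ^ 2) / (D x * √(D x) * q x) * D₂
        + -((4 + κ * x ^ 2) * (D x - 16) ^ 2 / (8 * √(D x) * x ^ 2 * q x ^ 3))) x := by
  have hDpos : 0 < D x := by
    rw [hDx]
    positivity
  have hR : 0 < √(D x) := Real.sqrt_pos.2 hDpos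
  have hsqrt : HasDerivAt (fun y => √(D y)) 0 x := by simpa using hD.sqrt hDpos.ne'
  have hsq : HasDerivAt (fun y : ℝ => y ^ 2) (2 * x) x := by simpa using hasDerivAt_pow 2 x
  have hm := (hsq.const_mul κ).const_add 4
  have he := (((hsq.const_mul (τ ^ 2)).const_add 1).const_mul 8)
  have hnum := (((hq.pow 2).const_mul 8).sub ((hD.sub_const 16).mul hm)).add
    ((((he.mul hm).mul (hasDerivAt_id x)).mul hD₁).div hD hDpos.ne')
  have hden := (((hasDerivAt_id x).const_mul 8).mul hq).mul hsqrt
  have hdiv := hnum.div hden (by simp [hx, hqx, hR.ne'])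
  refine hdiv.congr_deriv ?_
  have hq₁ : q₁ = -(16 * τ ^ 2 * x) / q x := by
    field_simp
    linear_combination hqq
  have hDne := hDpos.ne'
  have hRne := hR.ne'
  simp only [Pi.mul_apply, Pi.add_apply, Pi.sub_apply, Pi.pow_apply, Pi.div_apply, id_eq, h0, hq₁]
  generalize √(D x) = R at *
  field_simp
  rw [hDx]
  ring

lemma principal_mul_deriv_pos {H K r H₁ K₁ B C q D₂ s : ℝ} (hr : 0 < r) (hr2 : r ^ 2 = H ^ 2 - K)
    (hK : K < 0) (hH₁ : H₁ = B * D₂ + C) (hK₁ : K₁ = 2 * s * B * D₂) (hqB : 0 < q * B)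
    (hqC : q * C < 0) (hD₂ : D₂ ≤ 0) (hs : s ^ 2 - 2 * H * s + K ≤ 0) :
    0 < (H₁ + (2 * H * H₁ - K₁) / (2 * r)) * (H₁ - (2 * H * H₁ - K₁) / (2 * r)) := by
  have hHr : |H| < r := abs_lt_of_sq_lt_sq (by linarith) hr.le
  obtain ⟨hHr1, hHr2⟩ := abs_lt.1 hHr
  have hsr : |s - H| ≤ r := abs_le_of_sq_le_sq (by nlinarith) hr.le
  obtain ⟨hsr1, hsr2⟩ := abs_le.1 hsr
  set X := (H + r - s) * (B * D₂) + (H + r) * C with hX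
  set Y := (s - (H - r)) * (B * D₂) + (r - H) * C with hY
  have hqBD : q * B * D₂ ≤ 0 := mul_nonpos_of_nonneg_of_nonpos hqB.le hD₂
  have hqX : q * X < 0 := by
    have e1 : (H + r - s) * (q * B * D₂) ≤ 0 :=
      mul_nonpos_of_nonneg_of_nonpos (by linarith) hqBD
    have e2 : (H + r) * (q * C) < 0 := mul_neg_of_pos_of_neg (by linarith) hqC
    rw [hX]
    linarith
  have hqY : q * Y < 0 := by
    have e1 : (s - (H - r)) * (q * B * D₂) ≤ 0 :=
      mul_nonpos_of_nonneg_of_nonpos (by linarith) hqBD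
    have e2 : (r - H) * (q * C) < 0 := mul_neg_of_pos_of_neg (by linarith) hqC
    rw [hY]
    linarith
  have hXY : 0 < X * Y := by
    have h1 : 0 < q ^ 2 * (X * Y) := by
      have := mul_pos_of_neg_of_neg hqX hqY
      linarith
    exact pos_of_mul_pos_right h1 (sq_nonneg q)
  have e1 : H₁ + (2 * H * H₁ - K₁) / (2 * r) = X / r := by
    rw [hX, hH₁, hK₁]
    field_simp
    ring
  have e2 : H₁ - (2 * H * H₁ - K₁) / (2 * r) = Y / r := by
    rw [hY, hH₁, hK₁]
    field_simp
    ring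
  rw [e1, e2, div_mul_div_comm]
  positivity

lemma angleFn_sq_mem_Icc (κ τ : ℝ) (u : ℝ → ℝ) (ρ : ℝ) :
    angleFn κ τ u ρ ^ 2 ∈ Icc (0 : ℝ) 1 := by
  rw [angleFn_sq]
  have h := sixteen_le_Dfun κ τ u ρ
  have h' := Dfun_pos κ τ u ρ
  exact ⟨by positivity, (div_le_one h').2 h⟩

lemma hasDerivAt_angleFn_sq {κ τ x : ℝ} {u : ℝ → ℝ} (hD : HasDerivAt (Dfun κ τ u) 0 x) :
    HasDerivAt (fun y => angleFn κ τ u y ^ 2) 0 x := by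
  have h := (hasDerivAt_const x (16 : ℝ)).div hD (Dfun_pos κ τ u x).ne'
  have e : (fun y => angleFn κ τ u y ^ 2) = (fun _ => (16 : ℝ)) / Dfun κ τ u := by
    funext y
    simp [angleFn_sq]
  rw [e]
  simpa using h

/-- If `τ ≠ 0`, the function `D` has positive second derivative at its critical points. -/
lemma DfunDeriv_deriv_pos_of_ne_zero {κ τ δ x D₂ : ℝ} {u : ℝ → ℝ} {W : ℝ × ℝ × ℝ → ℝ}
    (hκdom : ∀ ρ ∈ Set.Ico (0 : ℝ) δ, 0 < 4 + κ * ρ ^ 2)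
    (hu : ContDiffOn ℝ (⊤ : ℕ∞) u (Set.Ico 0 δ))
    (hW : DifferentiableOn ℝ W weingartenDomain)
    (hWell : ∀ k₁ k₂ : ℝ, ∀ v ∈ Set.Icc (0 : ℝ) 1, W (k₁, k₂, v) = 0 →
      0 < deriv (fun x => W (x, k₂, v)) k₁ * deriv (fun y => W (k₁, y, v)) k₂)
    (hWein : ∀ ρ ∈ Set.Ioo 0 δ,
      W (meanCurv κ τ u ρ + √((meanCurv κ τ u ρ) ^ 2 - extCurv κ τ u ρ),
         meanCurv κ τ u ρ - √((meanCurv κ τ u ρ) ^ 2 - extCurv κ τ u ρ),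
         (angleFn κ τ u ρ) ^ 2) = 0)
    (hτ : τ ≠ 0) (hx : x ∈ Ioo 0 δ) (h0 : DfunDeriv κ τ u x = 0)
    (hD₂ : HasDerivAt (DfunDeriv κ τ u) D₂ x) : 0 < D₂ := by
  by_contra hneg
  have hD₂0 : D₂ ≤ 0 := not_lt.1 hneg
  have hx0 : 0 < x := hx.1
  have hxI : x ∈ Ico 0 δ := ⟨hx0.le, hx.2⟩
  have hm := hκdom x hxI
  have hnhds : Ici (0 : ℝ) ∈ 𝓝 x := Ici_mem_nhds hx0
  have hq := (hasDerivWithinAt_scaledSlope (κ := κ) hu hxI).hasDerivAt hnhds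
  have hD := (hasDerivWithinAt_Dfun (κ := κ) (τ := τ) hu hxI).hasDerivAt hnhds
  rw [h0] at hD
  have hqq : scaledSlope κ u x * scaledSlopeDeriv κ u x = -(16 * τ ^ 2 * x) := by
    unfold DfunDeriv at h0
    linarith
  have hqx : scaledSlope κ u x ≠ 0 := by
    intro h
    rw [h, zero_mul] at hqq
    have : 0 < 16 * τ ^ 2 * x := by positivity
    linarith
  have hDx := Dfun_eq κ τ u x
  have hDpos := Dfun_pos κ τ u x
  have hR : 0 < √(Dfun κ τ u x) := Real.sqrt_pos.2 hDpos
  have hR2 : √(Dfun κ τ u x) ^ 2 = Dfun κ τ u x := Real.sq_sqrt hDpos.le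
  have hH : HasDerivAt (meanCurv κ τ u) _ x :=
    (hasDerivAt_meanCurv_formula (κ := κ) hq hD hD₂ h0 hDx hqq
      hx0.ne' hqx).congr_of_eventuallyEq (by
      filter_upwards [hq.continuousAt.eventually_ne hqx, eventually_ne_nhds hx0.ne'] with y h1 h2
      exact meanCurv_eq κ τ u h2 h1)
  have hHx := meanCurv_eq κ τ u hx0.ne' hqx
  rw [h0, mul_zero, zero_div, add_zero] at hHx
  have hK : HasDerivAt (extCurv κ τ u) ((4 - (κ - 8 * τ ^ 2) * x ^ 2) * (4 + κ * x ^ 2)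
      * D₂ / (2 * x * Dfun κ τ u x ^ 2)) x := by
    have hsq : HasDerivAt (fun y : ℝ => y ^ 2) (2 * x) x := by simpa using hasDerivAt_pow 2 x
    have h1 := (((((hsq.const_mul (κ - 8 * τ ^ 2)).const_sub 4).mul
      ((hsq.const_mul κ).const_add 4)).mul hD₂).div
      (((hasDerivAt_id x).const_mul 2).mul (hD.pow 2)) (by simp [hx0.ne', hDpos.ne'])).const_add
        (-τ ^ 2)
    refine (h1.congr_of_eventuallyEq ?_).congr_deriv ?_
    · filter_upwards [eventually_ne_nhds hx0.ne'] with y h2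
      exact extCurv_eq κ τ u h2
    · simp only [Pi.mul_apply, Pi.pow_apply, id_eq, h0]
      have := hDpos.ne'
      field_simp
      ring
  have hKx := extCurv_eq κ τ u hx0.ne'
  rw [h0, mul_zero, zero_div, add_zero] at hKx
  have hK0 : extCurv κ τ u x < 0 := by
    rw [hKx]
    have : 0 < τ ^ 2 := by positivity
    linarith
  have hΔ : 0 < meanCurv κ τ u x ^ 2 - extCurv κ τ u x := by
    nlinarith [sq_nonneg (meanCurv κ τ u x)]
  have hr := Real.sqrt_pos.2 hΔ
  have hr2 := Real.sq_sqrt hΔ.le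
  have hsqrt := ((hH.pow 2).sub hK).sqrt hΔ.ne'
  have hDsub : Dfun κ τ u x - 16 ≠ 0 := by
    rw [hDx]
    have : 0 < scaledSlope κ u x ^ 2 + 16 * (τ ^ 2 * x ^ 2) := by positivity
    intro h
    linarith
  have hpos := principal_mul_deriv_pos (q := scaledSlope κ u x)
    (s := 4 * (4 - (κ - 8 * τ ^ 2) * x ^ 2) * scaledSlope κ u x
      / (x * (16 * (1 + τ ^ 2 * x ^ 2)) * √(Dfun κ τ u x)))
    hr hr2 hK0 rfl
    (K₁ := (4 - (κ - 8 * τ ^ 2) * x ^ 2) * (4 + κ * x ^ 2)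
      * D₂ / (2 * x * Dfun κ τ u x ^ 2))
    (B := (1 + τ ^ 2 * x ^ 2) * (4 + κ * x ^ 2)
      / (Dfun κ τ u x * √(Dfun κ τ u x) * scaledSlope κ u x))
    (C := -((4 + κ * x ^ 2) * (Dfun κ τ u x - 16) ^ 2
      / (8 * √(Dfun κ τ u x) * x ^ 2 * scaledSlope κ u x ^ 3))) (D₂ := D₂)
    (by
      have e : 1 + τ ^ 2 * x ^ 2 ≠ 0 := by positivity
      field_simp
      rw [hR2]
      ring)
    (by
      rw [mul_div_assoc', mul_comm (Dfun κ τ u x * _), mul_div_mul_left _ _ hqx]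
      positivity)
    (by
      have e : scaledSlope κ u x * -((4 + κ * x ^ 2) * (Dfun κ τ u x - 16) ^ 2
          / (8 * √(Dfun κ τ u x) * x ^ 2 * scaledSlope κ u x ^ 3))
          = -((4 + κ * x ^ 2) * (Dfun κ τ u x - 16) ^ 2
          / (8 * √(Dfun κ τ u x) * x ^ 2 * scaledSlope κ u x ^ 2)) := by
        field_simp
      rw [e, neg_lt_zero]
      positivity)
    hD₂0
    (by
      have e : 1 + τ ^ 2 * x ^ 2 ≠ 0 := by positivity
      have e3 : (4 * (4 - (κ - 8 * τ ^ 2) * x ^ 2) * scaledSlope κ u x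
          / (x * (16 * (1 + τ ^ 2 * x ^ 2)) * √(Dfun κ τ u x))) ^ 2
        - 2 * meanCurv κ τ u x * (4 * (4 - (κ - 8 * τ ^ 2) * x ^ 2) * scaledSlope κ u x
          / (x * (16 * (1 + τ ^ 2 * x ^ 2)) * √(Dfun κ τ u x))) + extCurv κ τ u x
        = -(τ ^ 2 * (4 + κ * x ^ 2 - 4 * (1 + τ ^ 2 * x ^ 2)) ^ 2
          / (16 * (1 + τ ^ 2 * x ^ 2) ^ 2)) := by
        rw [hHx, hKx]
        field_simp
        rw [hR2, hDx]
        ring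
      rw [e3, neg_nonpos]
      positivity)
  have hWneg := mul_deriv_neg_of_weingarten hW hWell (hH.add hsqrt) (hH.sub hsqrt)
    (hasDerivAt_angleFn_sq hD) (angleFn_sq_mem_Icc κ τ u)
    (by
      filter_upwards [Ioo_mem_nhds hx.1 hx.2] with y hy
      exact hWein y hy)
  simp only [Nat.cast_ofNat, Nat.add_one_sub_one, pow_one, Pi.sub_apply, Pi.pow_apply] at hWneg
  refine absurd (hWneg ?_) (not_lt.2 hpos.le)
  exact (right_ne_zero_of_mul hpos.ne')

/-! ### The case `τ = 0` -/

/-- The curvature of the meridians of the rotational graph, for `τ = 0`. -/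
noncomputable def meridianCurv (κ : ℝ) (u : ℝ → ℝ) (ρ : ℝ) : ℝ :=
  4 * (4 + κ * ρ ^ 2) * scaledSlopeDeriv κ u ρ / (Dfun κ 0 u ρ * √(Dfun κ 0 u ρ))

/-- The curvature of the parallels of the rotational graph, for `τ = 0`. -/
noncomputable def parallelCurv (κ : ℝ) (u : ℝ → ℝ) (ρ : ℝ) : ℝ :=
  (4 - κ * ρ ^ 2) / (4 * √(Dfun κ 0 u ρ)) * (scaledSlope κ u ρ / ρ)

lemma meanCurv_zero (κ : ℝ) (u : ℝ → ℝ) {ρ : ℝ} (hρ : ρ ≠ 0) :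
    meanCurv κ 0 u ρ = (meridianCurv κ u ρ + parallelCurv κ u ρ) / 2 := by
  have hD := Dfun_pos κ 0 u ρ
  have hR : √(Dfun κ 0 u ρ) ≠ 0 := (Real.sqrt_pos.2 hD).ne'
  have hR2 : √(Dfun κ 0 u ρ) ^ 2 = Dfun κ 0 u ρ := Real.sq_sqrt hD.le
  have hR3 : √(Dfun κ 0 u ρ) ^ 3 = Dfun κ 0 u ρ * √(Dfun κ 0 u ρ) := by rw [pow_succ, hR2]
  have hD' := hD.ne'
  unfold meanCurv meridianCurv parallelCurv
  rw [hR3]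
  field_simp
  unfold Dfun scaledSlope scaledSlopeDeriv
  ring

lemma extCurv_zero (κ : ℝ) (u : ℝ → ℝ) {ρ : ℝ} (hρ : ρ ≠ 0) :
    extCurv κ 0 u ρ = meridianCurv κ u ρ * parallelCurv κ u ρ := by
  have hD := Dfun_pos κ 0 u ρ
  have hR : √(Dfun κ 0 u ρ) ≠ 0 := (Real.sqrt_pos.2 hD).ne'
  have hR2 : √(Dfun κ 0 u ρ) ^ 2 = Dfun κ 0 u ρ := Real.sq_sqrt hD.le
  have hD' := hD.ne'
  rw [extCurv_eq κ 0 u hρ]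
  unfold meridianCurv parallelCurv DfunDeriv
  field_simp
  rw [hR2]
  ring

lemma weingarten_meridian_parallel {κ δ : ℝ} {u : ℝ → ℝ} {W : ℝ × ℝ × ℝ → ℝ}
    (hWsym : ∀ k₁ k₂ : ℝ, ∀ v ∈ Set.Icc (0 : ℝ) 1, W (k₁, k₂, v) = W (k₂, k₁, v))
    (hWein : ∀ ρ ∈ Set.Ioo 0 δ,
      W (meanCurv κ 0 u ρ + √((meanCurv κ 0 u ρ) ^ 2 - extCurv κ 0 u ρ),
         meanCurv κ 0 u ρ - √((meanCurv κ 0 u ρ) ^ 2 - extCurv κ 0 u ρ),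
         (angleFn κ 0 u ρ) ^ 2) = 0) {ρ : ℝ} (hρ : ρ ∈ Ioo 0 δ) :
    W (meridianCurv κ u ρ, parallelCurv κ u ρ, angleFn κ 0 u ρ ^ 2) = 0 := by
  have h := hWein ρ hρ
  rw [meanCurv_zero κ u hρ.1.ne', extCurv_zero κ u hρ.1.ne'] at h
  set t := meridianCurv κ u ρ
  set s := parallelCurv κ u ρ
  rw [show ((t + s) / 2) ^ 2 - t * s = ((t - s) / 2) ^ 2 by ring, Real.sqrt_sq_eq_abs] at h
  rcases abs_choice ((t - s) / 2) with h1 | h1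
  · rwa [h1, show (t + s) / 2 + (t - s) / 2 = t by ring,
      show (t + s) / 2 - (t - s) / 2 = s by ring] at h
  · rwa [h1, show (t + s) / 2 + -((t - s) / 2) = s by ring,
      show (t + s) / 2 - -((t - s) / 2) = t by ring,
      hWsym _ _ _ (angleFn_sq_mem_Icc κ 0 u ρ)] at h

/-- If `τ = 0`, the function `D` has positive second derivative at its critical points where the
slope does not vanish. -/
lemma DfunDeriv_deriv_pos_of_eq_zero {κ δ x D₂ : ℝ} {u : ℝ → ℝ} {W : ℝ × ℝ × ℝ → ℝ}
    (hκdom : ∀ ρ ∈ Set.Ico (0 : ℝ) δ, 0 < 4 + κ * ρ ^ 2)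
    (hu : ContDiffOn ℝ (⊤ : ℕ∞) u (Set.Ico 0 δ))
    (hW : DifferentiableOn ℝ W weingartenDomain)
    (hWell : ∀ k₁ k₂ : ℝ, ∀ v ∈ Set.Icc (0 : ℝ) 1, W (k₁, k₂, v) = 0 →
      0 < deriv (fun x => W (x, k₂, v)) k₁ * deriv (fun y => W (k₁, y, v)) k₂)
    (hWmp : ∀ ρ ∈ Set.Ioo 0 δ,
      W (meridianCurv κ u ρ, parallelCurv κ u ρ, angleFn κ 0 u ρ ^ 2) = 0)
    (hx : x ∈ Ioo 0 δ) (hqx : scaledSlope κ u x ≠ 0) (h0 : DfunDeriv κ 0 u x = 0)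
    (hD₂ : HasDerivAt (DfunDeriv κ 0 u) D₂ x) : 0 < D₂ := by
  by_contra hneg
  have hx0 : 0 < x := hx.1
  have hxI : x ∈ Ico 0 δ := ⟨hx0.le, hx.2⟩
  have hm := hκdom x hxI
  have hnhds : Ici (0 : ℝ) ∈ 𝓝 x := Ici_mem_nhds hx0
  have hq := (hasDerivWithinAt_scaledSlope (κ := κ) hu hxI).hasDerivAt hnhds
  have hD := (hasDerivWithinAt_Dfun (κ := κ) (τ := 0) hu hxI).hasDerivAt hnhds
  rw [h0] at hD
  have hq₁ : scaledSlopeDeriv κ u x = 0 := by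
    unfold DfunDeriv at h0
    simpa [hqx] using h0
  rw [hq₁] at hq
  obtain ⟨q₂, hq₂⟩ : ∃ q₂, HasDerivAt (scaledSlopeDeriv κ u) q₂ x :=
    ⟨_, ((hasDerivWithinAt_d1 (contDiffOn_scaledSlopeDeriv (κ := κ) hu) hxI).hasDerivAt hnhds)⟩
  have hD₂q : D₂ = 2 * scaledSlope κ u x * q₂ := by
    refine hD₂.unique ?_
    have := ((hq.const_mul 2).mul hq₂).add ((hasDerivAt_id x).const_mul (32 * (0 : ℝ) ^ 2))
    exact this.congr_deriv (by simp)
  have hDpos := Dfun_pos κ 0 u x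
  have hR : 0 < √(Dfun κ 0 u x) := Real.sqrt_pos.2 hDpos
  have hsqrt : HasDerivAt (fun y => √(Dfun κ 0 u y)) 0 x := by simpa using hD.sqrt hDpos.ne'
  have hsq : HasDerivAt (fun y : ℝ => y ^ 2) (2 * x) x := by simpa using hasDerivAt_pow 2 x
  have hDne := hDpos.ne'
  have hRne := hR.ne'
  have ht : HasDerivAt (meridianCurv κ u)
      (4 * (4 + κ * x ^ 2) * q₂ / (Dfun κ 0 u x * √(Dfun κ 0 u x))) x := by
    have h := ((((hsq.const_mul κ).const_add 4).const_mul 4).mul hq₂).div (hD.mul hsqrt)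
      (by simp [hDne, hRne])
    refine h.congr_deriv ?_
    simp only [Pi.mul_apply, hq₁]
    field_simp
    ring
  have hs : HasDerivAt (parallelCurv κ u)
      (-(scaledSlope κ u x * (4 + κ * x ^ 2) / (4 * x ^ 2 * √(Dfun κ 0 u x)))) x := by
    have h := (((hsq.const_mul κ).const_sub 4).div (hsqrt.const_mul 4) (by simp [hRne])).mul
      (hq.div (hasDerivAt_id x) hx0.ne')
    refine h.congr_deriv ?_
    simp only [Pi.div_apply, id_eq]
    field_simp
    ring
  have hWneg := mul_deriv_neg_of_weingarten hW hWell ht hs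
    (hasDerivAt_angleFn_sq hD) (angleFn_sq_mem_Icc κ 0 u)
    (by
      filter_upwards [Ioo_mem_nhds hx.1 hx.2] with y hy
      exact hWmp y hy)
    (by
      rw [neg_ne_zero]
      positivity)
  have e : 4 * (4 + κ * x ^ 2) * q₂ / (Dfun κ 0 u x * √(Dfun κ 0 u x))
      * -(scaledSlope κ u x * (4 + κ * x ^ 2) / (4 * x ^ 2 * √(Dfun κ 0 u x)))
      = -D₂ * ((4 + κ * x ^ 2) ^ 2 / (2 * x ^ 2 * Dfun κ 0 u x * √(Dfun κ 0 u x) ^ 2)) := by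
    rw [hD₂q]
    field_simp
  rw [e] at hWneg
  exact absurd hWneg (not_lt.2 (mul_nonneg (by linarith) (by positivity)))

lemma eventually_eq_zero_of_deriv_le {f f' : ℝ → ℝ} {x C : ℝ}
    (hf : ∀ᶠ y in 𝓝[≥] x, HasDerivWithinAt f (f' y) (Ici x) y) (hx : f x = 0)
    (hnn : ∀ y, 0 ≤ f y) (hle : ∀ᶠ y in 𝓝[>] x, f' y ≤ C * f y) :
    ∀ᶠ y in 𝓝[≥] x, f y = 0 := by
  obtain ⟨b, hb, hbI⟩ := mem_nhdsGE_iff_exists_Ico_subset.1 hf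
  obtain ⟨c, hc, hcI⟩ := mem_nhdsGT_iff_exists_Ioo_subset.1 hle
  have hxbc : x < min b c := lt_min hb hc
  have hanti : AntitoneOn (fun y => Real.exp (-C * y) * f y) (Ico x (min b c)) := by
    have hd : ∀ y ∈ Ico x (min b c), HasDerivWithinAt (fun y => Real.exp (-C * y) * f y)
        (Real.exp (-C * y) * (f' y - C * f y)) (Ici x) y := by
      intro y hy
      have h1 : HasDerivWithinAt f (f' y) (Ici x) y := hbI ⟨hy.1, hy.2.trans_le (min_le_left _ _)⟩
      have h2 := (((hasDerivAt_id y).const_mul (-C)).exp.hasDerivWithinAt (s := Ici x)).mul h1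
      refine h2.congr_deriv ?_
      simp only [id_eq]
      ring
    refine antitoneOn_of_hasDerivWithinAt_nonpos (convex_Ico _ _)
      (f' := fun y => Real.exp (-C * y) * (f' y - C * f y)) (fun y hy => ?_) (fun y hy => ?_)
      (fun y hy => ?_)
    · exact ((hd y hy).continuousWithinAt).mono Ico_subset_Ici_self
    · exact (hd y (interior_subset hy)).mono (interior_subset.trans Ico_subset_Ici_self)
    · rw [interior_Ico] at hy
      have h3 : f' y ≤ C * f y := hcI ⟨hy.1, hy.2.trans_le (min_le_right _ _)⟩
      exact mul_nonpos_of_nonneg_of_nonpos (Real.exp_pos _).le (by linarith)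
  filter_upwards [Ico_mem_nhdsGE hxbc] with y hy
  have h := hanti ⟨le_rfl, hxbc⟩ hy hy.1
  simp only [hx, mul_zero] at h
  have h4 : f y ≤ 0 := by
    by_contra h5
    have := mul_pos (Real.exp_pos (-C * y)) (not_le.1 h5)
    linarith
  exact le_antisymm h4 (hnn y)

lemma tendsto_curvatures {κ δ x : ℝ} {u : ℝ → ℝ} (hu : ContDiffOn ℝ (⊤ : ℕ∞) u (Set.Ico 0 δ))
    (hx : x ∈ Ico 0 δ) (hq : scaledSlope κ u x = 0) (hq₁ : scaledSlopeDeriv κ u x = 0) :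
    Tendsto (fun y => (meridianCurv κ u y, parallelCurv κ u y, angleFn κ 0 u y ^ 2)) (𝓝[>] x)
      (𝓝[weingartenDomain] (0, 0, 1)) := by
  have hle : 𝓝[>] x ≤ 𝓝[Ici 0] x :=
    nhdsWithin_mono _ fun y hy => hx.1.trans (le_of_lt hy)
  have hle' : 𝓝[>] x ≤ 𝓝 x := nhdsWithin_le_nhds
  have hqd := hasDerivWithinAt_scaledSlope (κ := κ) hu hx
  have hD : Tendsto (Dfun κ 0 u) (𝓝[>] x) (𝓝 (Dfun κ 0 u x)) :=
    (hasDerivWithinAt_Dfun hu hx).continuousWithinAt.mono_left hle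
  have hDx : Dfun κ 0 u x = 16 := by
    rw [Dfun_eq, hq]
    norm_num
  have hq₁t : Tendsto (scaledSlopeDeriv κ u) (𝓝[>] x) (𝓝 (scaledSlopeDeriv κ u x)) :=
    (hasDerivWithinAt_d1 (contDiffOn_scaledSlopeDeriv hu) hx).continuousWithinAt.mono_left hle
  have hR : Tendsto (fun y => √(Dfun κ 0 u y)) (𝓝[>] x) (𝓝 √(Dfun κ 0 u x)) := hD.sqrt
  have hRpos := Real.sqrt_pos.2 (Dfun_pos κ 0 u x)
  have hcont : ∀ c : ℝ, Tendsto (fun y : ℝ => 4 + c * y ^ 2) (𝓝[>] x) (𝓝 (4 + c * x ^ 2)) :=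
    fun c => (Continuous.tendsto (by fun_prop) x).mono_left hle'
  have hquot : Tendsto (fun y => scaledSlope κ u y / y) (𝓝[>] x) (𝓝 0) := by
    rcases hx.1.eq_or_lt with h0 | h0
    · subst h0
      have h := hasDerivWithinAt_iff_tendsto_slope.1 (hqd.mono Ioi_subset_Ici_self)
      rw [show Ioi (0 : ℝ) \ {0} = Ioi 0 by simp, hq₁] at h
      refine h.congr fun y => ?_
      rw [slope_def_field, hq, sub_zero, sub_zero]
    · have h := (hqd.continuousWithinAt.mono_left hle).div (tendsto_id.mono_left hle') h0.ne'
      rw [hq, zero_div] at h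
      exact h
  refine tendsto_nhdsWithin_iff.2 ⟨Tendsto.prodMk_nhds ?_ (Tendsto.prodMk_nhds ?_ ?_),
    Eventually.of_forall fun y => mem_weingartenDomain.2 (angleFn_sq_mem_Icc κ 0 u y)⟩
  · have h := (((hcont κ).const_mul 4).mul hq₁t).div (hD.mul hR)
      (mul_pos (Dfun_pos κ 0 u x) hRpos).ne'
    rw [hq₁, mul_zero, zero_div] at h
    exact h
  · have h := ((hcont (-κ)).div (hR.const_mul 4) (by positivity)).mul hquot
    rw [mul_zero] at h
    refine h.congr fun y => ?_
    simp only [Pi.div_apply, parallelCurv]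
    ring
  · have h := (tendsto_const_nhds (x := (16 : ℝ))).div hD (Dfun_pos κ 0 u x).ne'
    rw [hDx, div_self (by norm_num)] at h
    exact h.congr fun y => (angleFn_sq κ 0 u y).symm

lemma eventually_scaledSlope_eq_zero {κ δ x : ℝ} {u : ℝ → ℝ} {W : ℝ × ℝ × ℝ → ℝ}
    (hκdom : ∀ ρ ∈ Set.Ico (0 : ℝ) δ, 0 < 4 + κ * ρ ^ 2)
    (hu : ContDiffOn ℝ (⊤ : ℕ∞) u (Set.Ico 0 δ))
    (hW : DifferentiableOn ℝ W weingartenDomain)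
    (hWell : ∀ k₁ k₂ : ℝ, ∀ v ∈ Set.Icc (0 : ℝ) 1, W (k₁, k₂, v) = 0 →
      0 < deriv (fun x => W (x, k₂, v)) k₁ * deriv (fun y => W (k₁, y, v)) k₂)
    (hWmp : ∀ ρ ∈ Set.Ioo 0 δ,
      W (meridianCurv κ u ρ, parallelCurv κ u ρ, angleFn κ 0 u ρ ^ 2) = 0)
    (hW0 : W (0, 0, 1) = 0) (hx : x ∈ Ico 0 δ) (hq : scaledSlope κ u x = 0)
    (hq₁ : scaledSlopeDeriv κ u x = 0) : ∀ᶠ y in 𝓝[≥] x, scaledSlope κ u y = 0 := by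
  obtain ⟨C, hC, hCW⟩ := exists_eventually_mul_le_of_weingarten hW hWell hW0
  have hev := (tendsto_curvatures hu hx hq hq₁).eventually hCW
  have hδ : 0 < δ := hx.1.trans_lt hx.2
  have hDsub : ∀ y, Dfun κ 0 u y - 16 = scaledSlope κ u y ^ 2 := fun y => by
    rw [Dfun_eq]
    ring
  have hm := hκdom x hx
  have hle : 𝓝[>] x ≤ 𝓝[Ici 0] x :=
    nhdsWithin_mono _ fun y hy => hx.1.trans (le_of_lt hy)
  have hD : Tendsto (Dfun κ 0 u) (𝓝[>] x) (𝓝 (Dfun κ 0 u x)) :=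
    (hasDerivWithinAt_Dfun hu hx).continuousWithinAt.mono_left hle
  have hmt : Tendsto (fun y : ℝ => 4 + κ * y ^ 2) (𝓝[>] x) (𝓝 (4 + κ * x ^ 2)) :=
    (Continuous.tendsto (by fun_prop) x).mono_left nhdsWithin_le_nhds
  have hquot := (hD.mul hD.sqrt).div (hmt.const_mul 2) (by positivity)
  set M := Dfun κ 0 u x * √(Dfun κ 0 u x) / (2 * (4 + κ * x ^ 2)) + 1
  have hMpos : 0 < M := by
    have := Dfun_pos κ 0 u x
    positivity
  have key : ∀ᶠ y in 𝓝[≥] x, Dfun κ 0 u y - 16 = 0 := by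
    refine eventually_eq_zero_of_deriv_le (f' := DfunDeriv κ 0 u)
      (C := M * (C * (|κ| * δ + 1))) ?_ (by rw [hDsub, hq]; norm_num)
      (fun y => by rw [hDsub]; positivity) ?_
    · filter_upwards [Ico_mem_nhdsGE hx.2] with y hy
      exact ((hasDerivWithinAt_Dfun hu ⟨hx.1.trans hy.1, hy.2⟩).sub_const 16).mono
        (Ici_subset_Ici.2 hx.1)
    · filter_upwards [hev, Ioo_mem_nhdsGT hx.2,
        hquot.eventually (gt_mem_nhds (lt_add_one _))] with y hy hyI hyM
      have hy0 : 0 < y := hx.1.trans_lt hyI.1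
      have hmy := hκdom y ⟨hy0.le, hyI.2⟩
      have hDy := Dfun_pos κ 0 u y
      have hD16 := sixteen_le_Dfun κ 0 u y
      have hRy := Real.sqrt_pos.2 hDy
      have hR1 : 1 ≤ √(Dfun κ 0 u y) := Real.one_le_sqrt.2 (by linarith)
      have hbound := hy (hWmp y ⟨hy0, hyI.2⟩) (scaledSlope κ u y)
      rw [hDsub]
      set q := scaledSlope κ u y with hqdef
      have hpar : max 0 (-(q * parallelCurv κ u y)) ≤ |κ| * δ * q ^ 2 := by
        refine max_le (by positivity) ?_
        have e : -(q * parallelCurv κ u y)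
            = (κ * y ^ 2 - 4) / (4 * y * √(Dfun κ 0 u y)) * q ^ 2 := by
          unfold parallelCurv
          rw [← hqdef]
          field_simp
          ring
        rw [e]
        gcongr
        rw [div_le_iff₀ (by positivity)]
        have e1 : κ * y ^ 2 ≤ |κ| * y ^ 2 := by
          gcongr
          exact le_abs_self κ
        have e2 : |κ| * y ^ 2 ≤ |κ| * δ * y := by
          have : |κ| * y * y ≤ |κ| * y * δ := by
            gcongr
            exact hyI.2.le
          linarith
        have e3 : |κ| * δ * y * 1 ≤ |κ| * δ * y * (4 * √(Dfun κ 0 u y)) := by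
          gcongr
          linarith
        linarith
      have hang : |q| * |angleFn κ 0 u y ^ 2 - 1| ≤ q ^ 2 := by
        have e : angleFn κ 0 u y ^ 2 - 1 = -(q ^ 2 / Dfun κ 0 u y) := by
          rw [angleFn_sq, ← hDsub y]
          field_simp
          ring
        have e' : 0 ≤ q ^ 2 / Dfun κ 0 u y := by positivity
        rw [e, abs_neg, abs_of_nonneg e', mul_div_assoc', div_le_iff₀ hDy, mul_comm]
        gcongr
        have := hDsub y
        nlinarith [sq_nonneg (|q| - 1), sq_abs q]
      have hmer : DfunDeriv κ 0 u y
          = Dfun κ 0 u y * √(Dfun κ 0 u y) / (2 * (4 + κ * y ^ 2)) * (q * meridianCurv κ u y) := by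
        have hmy' := hmy.ne'
        unfold meridianCurv DfunDeriv
        rw [← hqdef]
        generalize 4 + κ * y ^ 2 = m at hmy' ⊢
        field_simp
        ring
      have hqt : q * meridianCurv κ u y ≤ C * (|κ| * δ + 1) * q ^ 2 := by
        refine hbound.trans ?_
        have : C * (max 0 (-(q * parallelCurv κ u y)) + |q| * |angleFn κ 0 u y ^ 2 - 1|)
            ≤ C * (|κ| * δ * q ^ 2 + q ^ 2) := by gcongr
        linarith
      rw [hmer]
      calc _ ≤ Dfun κ 0 u y * √(Dfun κ 0 u y) / (2 * (4 + κ * y ^ 2))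
            * (C * (|κ| * δ + 1) * q ^ 2) := by gcongr
        _ ≤ M * (C * (|κ| * δ + 1) * q ^ 2) := by
            gcongr
            exact hyM.le
        _ = _ := by ring
  filter_upwards [key] with y hy
  rw [hDsub] at hy
  exact pow_eq_zero_iff (two_ne_zero) |>.1 hy

/-- A solution with `τ = 0` that is flat to second order at the axis vanishes identically. -/
lemma eq_zero_of_d2_eq_zero {κ δ : ℝ} {u : ℝ → ℝ} {W : ℝ × ℝ × ℝ → ℝ} (hδ : 0 < δ)
    (hκdom : ∀ ρ ∈ Set.Ico (0 : ℝ) δ, 0 < 4 + κ * ρ ^ 2)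
    (hu : ContDiffOn ℝ (⊤ : ℕ∞) u (Set.Ico 0 δ)) (hu0 : u 0 = 0) (hu'0 : d1 u 0 = 0)
    (hW : DifferentiableOn ℝ W weingartenDomain)
    (hWell : ∀ k₁ k₂ : ℝ, ∀ v ∈ Set.Icc (0 : ℝ) 1, W (k₁, k₂, v) = 0 →
      0 < deriv (fun x => W (x, k₂, v)) k₁ * deriv (fun y => W (k₁, y, v)) k₂)
    (hWmp : ∀ ρ ∈ Set.Ioo 0 δ,
      W (meridianCurv κ u ρ, parallelCurv κ u ρ, angleFn κ 0 u ρ ^ 2) = 0)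
    (h2 : d2 u 0 = 0) : ∀ ρ ∈ Ico 0 δ, u ρ = 0 := by
  have h0I : (0 : ℝ) ∈ Ico 0 δ := ⟨le_rfl, hδ⟩
  have hq0 : scaledSlope κ u 0 = 0 := by simp [scaledSlope, hu'0]
  have hq₁0 : scaledSlopeDeriv κ u 0 = 0 := by simp [scaledSlopeDeriv, h2]
  have hW0 : W (0, 0, 1) = 0 := by
    have hc : Tendsto W (𝓝[weingartenDomain] (0, 0, 1)) (𝓝 (W (0, 0, 1))) :=
      hW.continuousOn _ (mem_weingartenDomain.2 ⟨zero_le_one, le_rfl⟩)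
    have ht := hc.comp (tendsto_curvatures hu h0I hq0 hq₁0)
    refine tendsto_nhds_unique ht (tendsto_const_nhds.congr' ?_)
    filter_upwards [Ioo_mem_nhdsGT hδ] with y hy
    exact (hWmp y hy).symm
  have hq : ∀ b ∈ Ico 0 δ, scaledSlope κ u b = 0 := by
    intro b hb
    have hsub : Icc 0 b ⊆ Ico 0 δ := fun y hy => ⟨hy.1, hy.2.trans_lt hb.2⟩
    have hpair : ContinuousOn (fun y => (scaledSlope κ u y, scaledSlopeDeriv κ u y)) (Icc 0 b) :=
      ((contDiffOn_scaledSlope hu).continuousOn.mono hsub).prodMk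
        ((contDiffOn_scaledSlopeDeriv hu).continuousOn.mono hsub)
    have hcl : IsClosed ({y | (scaledSlope κ u y, scaledSlopeDeriv κ u y) = (0, 0)} ∩ Icc 0 b) := by
      rw [inter_comm]
      exact hpair.preimage_isClosed_of_isClosed isClosed_Icc (isClosed_singleton (x := (0, 0)))
    have hall := hcl.Icc_subset_of_forall_mem_nhdsWithin (by simp [hq0, hq₁0]) (fun y hy => ?_)
    · have := hall ⟨hb.1, le_rfl⟩
      exact (Prod.mk.inj this).1
    have hyI : y ∈ Ico 0 δ := ⟨hy.2.1, hy.2.2.trans hb.2⟩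
    have hy1 := Prod.mk.inj hy.1
    obtain ⟨c, hc, hcI⟩ := mem_nhdsGE_iff_exists_Ico_subset.1
      (eventually_scaledSlope_eq_zero hκdom hu hW hWell hWmp hW0 hyI hy1.1 hy1.2)
    filter_upwards [Ioo_mem_nhdsGT hc, Ioo_mem_nhdsGT hyI.2] with z hz hz2
    have hz0 : 0 < z := hyI.1.trans_lt hz.1
    have hd := (hasDerivWithinAt_scaledSlope (κ := κ) hu ⟨hz0.le, hz2.2⟩).hasDerivAt
      (Ici_mem_nhds hz0)
    have hd0 : HasDerivAt (scaledSlope κ u) 0 z := by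
      refine (hasDerivAt_const z (0 : ℝ)).congr_of_eventuallyEq ?_
      filter_upwards [Ioo_mem_nhds hz.1 hz.2] with w hw
      exact hcI ⟨hw.1.le, hw.2⟩
    exact Prod.ext (hcI ⟨hz.1.le, hz.2⟩) (hd.unique hd0)
  have hd1 : ∀ y ∈ Ico 0 δ, d1 u y = 0 := fun y hy =>
    (mul_eq_zero.1 (hq y hy)).resolve_right (hκdom y hy).ne'
  intro ρ hρ
  have hsub : Icc 0 ρ ⊆ Ico 0 δ := fun y hy => ⟨hy.1, hy.2.trans_lt hρ.2⟩
  rw [← hu0]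
  refine constant_of_has_deriv_right_zero (hu.continuousOn.mono hsub) (fun y hy => ?_) ρ
    ⟨hρ.1, le_rfl⟩
  have hyI : y ∈ Ico 0 δ := ⟨hy.1, hy.2.trans hρ.2⟩
  have h := hasDerivWithinAt_d1 hu hyI
  rw [hd1 y hyI] at h
  exact h.mono (Ici_subset_Ici.2 hy.1)

/-- Monotonicity of the angle function of a radial graph in `E³(κ,τ)` satisfying a
general elliptic Weingarten equation `W(κ₁, κ₂, ν²) = 0`. -/
theorem angle_monotonicity (κ τ δ : ℝ) (hδ : 0 < δ)
    (hκdom : ∀ ρ ∈ Set.Ico (0 : ℝ) δ, 0 < 4 + κ * ρ ^ 2)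
    (u : ℝ → ℝ) (hu : ContDiffOn ℝ (⊤ : ℕ∞) u (Set.Ico 0 δ))
    (hu0 : u 0 = 0) (hu'0 : d1 u 0 = 0)
    (W : ℝ × ℝ × ℝ → ℝ)
    (hW : ContDiffOn ℝ (⊤ : ℕ∞) W (Set.univ ×ˢ Set.univ ×ˢ Set.Icc 0 1))
    (hWsym : ∀ k₁ k₂ : ℝ, ∀ v ∈ Set.Icc (0 : ℝ) 1, W (k₁, k₂, v) = W (k₂, k₁, v))
    (hWell : ∀ k₁ k₂ : ℝ, ∀ v ∈ Set.Icc (0 : ℝ) 1, W (k₁, k₂, v) = 0 →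
      0 < deriv (fun x => W (x, k₂, v)) k₁ * deriv (fun y => W (k₁, y, v)) k₂)
    (hWein : ∀ ρ ∈ Set.Ioo 0 δ,
      extCurv κ τ u ρ ≤ (meanCurv κ τ u ρ) ^ 2 ∧
      W (meanCurv κ τ u ρ + Real.sqrt ((meanCurv κ τ u ρ) ^ 2 - extCurv κ τ u ρ),
         meanCurv κ τ u ρ - Real.sqrt ((meanCurv κ τ u ρ) ^ 2 - extCurv κ τ u ρ),
         (angleFn κ τ u ρ) ^ 2) = 0)
    (hτ : τ = 0 → ∃ ρ ∈ Set.Ico (0 : ℝ) δ, u ρ ≠ 0) :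
    StrictAntiOn (angleFn κ τ u) (Set.Ico 0 δ) ∧
    (τ = 0 → ∀ ρ ∈ Set.Ioo (0 : ℝ) δ, d1 u ρ ≠ 0) := by
  have hW' : DifferentiableOn ℝ W weingartenDomain := hW.differentiableOn (by simp)
  have hWein' := fun ρ hρ => (hWein ρ hρ).2
  have h0I : (0 : ℝ) ∈ Ico 0 δ := ⟨le_rfl, hδ⟩
  have hd2 : τ = 0 → d2 u 0 ≠ 0 := by
    intro h h2
    subst h
    obtain ⟨ρ, hρ, hne⟩ := hτ rfl
    exact hne (eq_zero_of_d2_eq_zero hδ hκdom hu hu0 hu'0 hW' hWell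
      (fun y hy => weingarten_meridian_parallel hWsym hWein' hy) h2 ρ hρ)
  have hq0 : scaledSlope κ u 0 = 0 := by simp [scaledSlope, hu'0]
  have hDd := fun x (hx : x ∈ Ico 0 δ) =>
    hasDerivWithinAt_d1 (contDiffOn_DfunDeriv (κ := κ) (τ := τ) hu) hx
  have hpos0 : ∀ᶠ x in 𝓝[>] (0 : ℝ), 0 < DfunDeriv κ τ u x := by
    have h1 := (((hasDerivWithinAt_scaledSlope (κ := κ) hu h0I).const_mul 2).mul
      (hasDerivWithinAt_d1 (contDiffOn_scaledSlopeDeriv (κ := κ) hu) h0I)).add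
      ((hasDerivWithinAt_id (0 : ℝ) (Ici 0)).const_mul (32 * τ ^ 2))
    refine HasDerivWithinAt.eventually_pos (f := DfunDeriv κ τ u) h1 (by simp [DfunDeriv, hq0]) ?_
    simp only [hq0, scaledSlopeDeriv]
    rcases eq_or_ne τ 0 with h | h
    · have := hd2 h
      have : 0 < d2 u 0 ^ 2 := by positivity
      nlinarith [sq_nonneg τ]
    · have : 0 < τ ^ 2 := by positivity
      nlinarith [sq_nonneg (d2 u 0)]
  obtain ⟨ε, hε, hεI⟩ := mem_nhdsGT_iff_exists_Ioo_subset.1 hpos0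
  have hε' : 0 < ε := hε
  have hDmono : ∀ c ≤ δ, (∀ x ∈ Ioo 0 c, 0 < DfunDeriv κ τ u x) →
      ∀ s ⊆ Ico 0 δ, Convex ℝ s → interior s ⊆ Ioo 0 c → StrictMonoOn (Dfun κ τ u) s := by
    intro c hc hpos s hs hconv hint
    refine strictMonoOn_of_hasDerivWithinAt_pos hconv (f' := DfunDeriv κ τ u) (fun x hx => ?_)
      (fun x hx => ?_) (fun x hx => hpos x (hint hx))
    · exact (hasDerivWithinAt_Dfun hu (hs hx)).continuousWithinAt.mono fun y hy => (hs hy).1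
    · exact (hasDerivWithinAt_Dfun hu (hs (interior_subset hx))).mono
        fun y hy => (hs (interior_subset hy)).1
  have hpos : ∀ x ∈ Ioo 0 δ, 0 < DfunDeriv κ τ u x := by
    intro b hb
    by_contra hneg
    have hεb : ε ≤ b := by
      by_contra h
      exact hneg (hεI ⟨hb.1, not_le.1 h⟩)
    have hsub : Icc (ε / 2) b ⊆ Ico 0 δ := fun y hy => ⟨by linarith [hy.1], hy.2.trans_lt hb.2⟩
    obtain ⟨c, hc, hc0, hcpos⟩ := exists_first_zero (a := ε / 2) (b := b) (by linarith)
      ((contDiffOn_DfunDeriv hu).continuousOn.mono hsub)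
      (hεI ⟨by linarith, by linarith⟩) (not_lt.1 hneg)
    have hcI : c ∈ Ioo 0 δ := ⟨by linarith [hc.1], hc.2.trans_lt hb.2⟩
    have hcI' : c ∈ Ico 0 δ := ⟨hcI.1.le, hcI.2⟩
    have hD₂ := (hDd c hcI').hasDerivAt (Ici_mem_nhds hcI.1)
    have hD₂np := hD₂.nonpos_of_pos_left hc.1 hc0 hcpos
    refine absurd ?_ (not_lt.2 hD₂np)
    rcases eq_or_ne τ 0 with h | h
    · subst h
      have hmono := hDmono c hcI.2.le (fun x hx => by
        rcases lt_or_ge x (ε / 2) with h1 | h1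
        · exact hεI ⟨hx.1, by linarith⟩
        · exact hcpos x ⟨h1, hx.2⟩) (Icc 0 c) (fun y hy => ⟨hy.1, hy.2.trans_lt hcI.2⟩)
          (convex_Icc _ _) (by rw [interior_Icc])
      have hlt := hmono ⟨le_rfl, hcI.1.le⟩ ⟨hcI.1.le, le_rfl⟩ hcI.1
      refine DfunDeriv_deriv_pos_of_eq_zero hκdom hu hW' hWell
        (fun y hy => weingarten_meridian_parallel hWsym hWein' hy) hcI (fun hqc => ?_) hc0 hD₂
      simp only [Dfun_eq, hq0, hqc] at hlt
      norm_num at hlt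
    · exact DfunDeriv_deriv_pos_of_ne_zero hκdom hu hW' hWell hWein' h hcI hc0 hD₂
  have hmono := hDmono δ le_rfl hpos (Ico 0 δ) subset_rfl (convex_Ico _ _) (by rw [interior_Ico])
  refine ⟨fun x hx y hy hxy => ?_, fun h ρ hρ hd => ?_⟩
  · have hD := Dfun_pos κ τ u x
    have h := Real.sqrt_lt_sqrt hD.le (hmono hx hy hxy)
    exact div_lt_div_of_pos_left (by norm_num) (Real.sqrt_pos.2 hD) h
  · have hlt := hmono h0I ⟨hρ.1.le, hρ.2⟩ hρ.1
    subst h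
    have hqρ : scaledSlope κ u ρ = 0 := by simp [scaledSlope, hd]
    simp only [Dfun_eq, hq0, hqρ] at hlt
    norm_num at hlt
end

section
/- Let W : ℝ² → ℝ be C^∞, symmetric (W(k₁,k₂) = W(k₂,k₁) for all k₁,k₂), and satisfying the ellipticity condition (∂W/∂k₁)(∂W/∂k₂) > 0 at every point of W⁻¹(0). Let Γ be a nonempty connected component of W⁻¹(0) that is invariant under the reflection (k₁,k₂) ↦ (k₂,k₁). Then there exists a function φ : [0,∞) → ℝ of class C^∞ such that 4t·φ'(t)² < 1 for every t ≥ 0 and Γ = {(k₁,k₂) ∈ ℝ² : (k₁+k₂)/2 = φ((k₁−k₂)²/4)}. -/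
open Set Filter Topology

/-- Weighted averages of a smooth function along the segment from `0` to `x` depend smoothly
on `x`. -/
lemma contDiff_integral_pow_mul_comp_mul (n m : ℕ) {f : ℝ → ℝ} (hf : ContDiff ℝ (⊤ : ℕ∞) f) :
    ContDiff ℝ n (fun x => ∫ s in (0 : ℝ)..1, s ^ m * f (s * x)) := by
  induction n generalizing m f with
  | zero =>
    have := hf.continuous
    exact contDiff_zero.2
      (intervalIntegral.continuous_parametric_intervalIntegral_of_continuous' (by fun_prop) 0 1)
  | succ n ih =>
    have hf' : ContDiff ℝ (⊤ : ℕ∞) (deriv f) := (contDiff_infty_iff_deriv.1 hf).2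
    have cf := hf.continuous
    have cf' := hf'.continuous
    have key : ∀ x, HasDerivAt (fun x => ∫ s in (0 : ℝ)..1, s ^ m * f (s * x))
        (∫ s in (0 : ℝ)..1, s ^ (m + 1) * deriv f (s * x)) x := by
      intro x
      obtain ⟨C, hC⟩ := ((isCompact_Icc (a := (0 : ℝ)) (b := 1)).prod
        (isCompact_closedBall x 1)).exists_bound_of_continuousOn
        (f := fun q : ℝ × ℝ => q.1 ^ (m + 1) * deriv f (q.1 * q.2)) (by fun_prop)
      refine (intervalIntegral.hasDerivAt_integral_of_dominated_loc_of_deriv_le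
        (F' := fun x s => s ^ (m + 1) * deriv f (s * x)) (bound := fun _ => C)
        (Metric.closedBall_mem_nhds x one_pos) (.of_forall fun y => ?_) ?_ ?_
        (.of_forall fun s hs y hy => ?_) ?_ (.of_forall fun s hs y hy => ?_)).2
      · exact Continuous.aestronglyMeasurable (by fun_prop)
      · exact Continuous.intervalIntegrable (by fun_prop) _ _
      · exact Continuous.aestronglyMeasurable (by fun_prop)
      · rw [uIoc_of_le zero_le_one] at hs
        exact hC (s, y) ⟨Ioc_subset_Icc_self hs, hy⟩
      · simp
      · have h1 : HasDerivAt f (deriv f (s * y)) (s * y) :=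
          (hf.differentiable (by simp) _).hasDerivAt
        refine ((h1.comp y ((hasDerivAt_id y).const_mul s)).const_mul (s ^ m)).congr_deriv ?_
        ring
    push_cast
    refine contDiff_succ_iff_deriv.2 ⟨fun x => (key x).differentiableAt, by simp, ?_⟩
    rw [show deriv _ = _ from funext fun x => (key x).deriv]
    exact ih (m + 1) hf'

/-- The derivative of an even smooth function is divisible by the coordinate, with an even
smooth quotient. -/
lemma exists_even_deriv_eq_mul {h : ℝ → ℝ} (hh : ContDiff ℝ (⊤ : ℕ∞) h)
    (heven : ∀ x, h (-x) = h x) :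
    ∃ k : ℝ → ℝ, ContDiff ℝ (⊤ : ℕ∞) k ∧ (∀ x, k (-x) = k x) ∧ ∀ x, deriv h x = x * k x := by
  have hodd : ∀ x, deriv h (-x) = -deriv h x := fun x => by
    have := deriv_comp_neg h x
    simp only [heven] at this
    linarith
  have h1 : ContDiff ℝ (⊤ : ℕ∞) (deriv h) := (contDiff_infty_iff_deriv.1 hh).2
  have h2 : ContDiff ℝ (⊤ : ℕ∞) (deriv (deriv h)) := (contDiff_infty_iff_deriv.1 h1).2
  refine ⟨fun x => ∫ s in (0 : ℝ)..1, deriv (deriv h) (s * x), ?_, fun x => ?_, fun x => ?_⟩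
  · refine contDiff_infty.2 fun n => ?_
    simpa using contDiff_integral_pow_mul_comp_mul n 0 h2
  · refine intervalIntegral.integral_congr fun s _ => ?_
    have := deriv_comp_neg (deriv h) (s * x)
    simp only [hodd, deriv.fun_neg] at this
    simp only [mul_neg]
    linarith
  · have h0 : deriv h 0 = 0 := by
      have := hodd 0
      rw [neg_zero] at this
      linarith
    have := intervalIntegral.integral_deriv_of_contDiffOn_uIcc (a := 0 * x) (b := 1 * x)
      (h1.contDiffOn.of_le (by exact_mod_cast le_top) : ContDiffOn ℝ 1 (deriv h) _)
    rw [← intervalIntegral.mul_integral_comp_mul_right] at this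
    rw [this]; simp [h0]

lemma hasDerivWithinAt_comp_sqrt {h k : ℝ → ℝ} (hh : ContDiff ℝ (⊤ : ℕ∞) h)
    (hk : Continuous k) (hhk : ∀ x, deriv h x = x * k x) {t : ℝ} (ht : 0 ≤ t) :
    HasDerivWithinAt (fun t => h √t) (k √t / 2) (Ici 0) t := by
  have hpos : ∀ t : ℝ, 0 < t → HasDerivAt (fun t => h √t) (k √t / 2) t := fun t ht => by
    have h1 : HasDerivAt h (deriv h √t) √t := (hh.differentiable (by simp) _).hasDerivAt
    refine (h1.comp t (Real.hasDerivAt_sqrt ht.ne')).congr_deriv ?_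
    have := Real.sqrt_pos.2 ht
    rw [hhk]; field_simp
  rcases ht.eq_or_lt with rfl | ht
  · have := hh.continuous
    refine hasDerivWithinAt_Ici_of_tendsto_deriv (s := Ioi 0)
      (fun t ht => (hpos t ht).differentiableAt.differentiableWithinAt)
      (Continuous.continuousWithinAt (by fun_prop)) self_mem_nhdsWithin ?_
    have hc : Continuous fun t => k √t / 2 := by fun_prop
    refine (hc.continuousWithinAt (s := Ioi 0) (x := 0)).tendsto.congr' ?_
    filter_upwards [self_mem_nhdsWithin] with t ht using (hpos t ht).deriv.symm
  · exact (hpos t ht).hasDerivWithinAt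

/-- An even smooth function is a smooth function of the square of the coordinate. -/
lemma contDiffOn_comp_sqrt_of_even {h : ℝ → ℝ} (hh : ContDiff ℝ (⊤ : ℕ∞) h)
    (heven : ∀ x, h (-x) = h x) : ContDiffOn ℝ (⊤ : ℕ∞) (fun t => h √t) (Ici 0) := by
  refine contDiffOn_infty.2 fun n => ?_
  induction n generalizing h with
  | zero =>
    have := hh.continuous
    exact contDiffOn_zero.2 (by fun_prop)
  | succ n ih =>
    obtain ⟨k, hk, hkeven, hhk⟩ := exists_even_deriv_eq_mul hh heven
    have key := fun t (ht : 0 ≤ t) => hasDerivWithinAt_comp_sqrt hh hk.continuous hhk ht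
    push_cast
    refine (contDiffOn_succ_iff_derivWithin (uniqueDiffOn_Ici 0)).2
      ⟨fun t ht => (key t ht).differentiableWithinAt, by simp, ?_⟩
    exact ((ih hk hkeven).div_const 2).congr fun t ht =>
      (key t ht).derivWithin (uniqueDiffOn_Ici 0 t ht)

/-- A subset of the plane is a local graph of slope less than one if around each of its points it
coincides with the graph, over the first coordinate, of a smooth function whose derivative at the
point has absolute value less than one. -/
def IsLocalGraphSlopeLtOne (Z : Set (ℝ × ℝ)) : Prop :=
  ∀ q ∈ Z, ∃ g : ℝ → ℝ, ContDiffAt ℝ (⊤ : ℕ∞) g q.1 ∧ |deriv g q.1| < 1 ∧ g q.1 = q.2 ∧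
    ∀ᶠ v in 𝓝 q, v ∈ Z ↔ g v.1 = v.2

lemma eventually_eq_of_graph_subset {Z : Set (ℝ × ℝ)} {g h : ℝ → ℝ} {s : Set ℝ} {x : ℝ}
    (hg : ∀ᶠ v in 𝓝 (x, h x), v ∈ Z ↔ g v.1 = v.2) (hh : ContinuousWithinAt h s x)
    (hZ : ∀ y ∈ s, (y, h y) ∈ Z) : ∀ᶠ y in 𝓝[s] x, g y = h y := by
  have hc : ContinuousWithinAt (fun y => (y, h y)) s x := continuousWithinAt_id.prodMk hh
  filter_upwards [hc.eventually hg, self_mem_nhdsWithin] with y hy hys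
  exact hy.1 (hZ y hys)

namespace IsLocalGraphSlopeLtOne

variable {Z : Set (ℝ × ℝ)}

lemma eqOn_Icc (hloc : IsLocalGraphSlopeLtOne Z) {a b : ℝ} {h₁ h₂ : ℝ → ℝ}
    (c₁ : ContinuousOn h₁ (Icc a b)) (c₂ : ContinuousOn h₂ (Icc a b))
    (z₁ : ∀ x ∈ Icc a b, (x, h₁ x) ∈ Z) (z₂ : ∀ x ∈ Icc a b, (x, h₂ x) ∈ Z)
    (ha : h₁ a = h₂ a) : EqOn h₁ h₂ (Icc a b) := by
  have hcl : IsClosed ((fun x => h₁ x - h₂ x) ⁻¹' {0} ∩ Icc a b) := by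
    rw [inter_comm]
    exact (c₁.sub c₂).preimage_isClosed_of_isClosed isClosed_Icc isClosed_singleton
  have := hcl.Icc_subset_of_forall_exists_gt (by simp [ha]) fun x hx y hy => ?_
  · exact fun x hx => sub_eq_zero.1 (this hx)
  obtain ⟨hx, hxab⟩ := hx
  have hx : h₁ x = h₂ x := sub_eq_zero.1 hx
  have hxI := Ico_subset_Icc_self hxab
  obtain ⟨g, -, -, -, hg⟩ := hloc _ (z₁ x hxI)
  have e₁ := eventually_eq_of_graph_subset hg (c₁ x hxI) z₁
  rw [hx] at hg
  have e₂ := eventually_eq_of_graph_subset hg (c₂ x hxI) z₂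
  have hle : 𝓝[>] x ≤ 𝓝[Icc a b] x :=
    nhdsWithin_le_of_mem (Icc_mem_nhdsGT_of_mem hxab)
  obtain ⟨u, hu, hu₁, hu₂⟩ :=
    ((eventually_mem_set.2 (Ioc_mem_nhdsGT hy)).and
      ((e₁.filter_mono hle).and (e₂.filter_mono hle))).exists
  exact ⟨u, by simp [← hu₁, ← hu₂], hu⟩

/-- Existence of a curve in `Z` through `(a, c)`, over `[a, b]`. -/
def HasCurve (Z : Set (ℝ × ℝ)) (a c b : ℝ) : Prop :=
  ∃ h : ℝ → ℝ, LipschitzOnWith 1 h (Icc a b) ∧ h a = c ∧ ∀ x ∈ Icc a b, (x, h x) ∈ Z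

lemma HasCurve.mono {a b b' c : ℝ} (hb : HasCurve Z a c b) (hle : b' ≤ b) :
    HasCurve Z a c b' := by
  obtain ⟨h, hl, ha, hz⟩ := hb
  have hs : Icc a b' ⊆ Icc a b := Icc_subset_Icc_right hle
  exact ⟨h, hl.mono hs, ha, fun x hx => hz x (hs hx)⟩

lemma exists_lipschitzWith_of_hasCurve (hloc : IsLocalGraphSlopeLtOne Z) {a c : ℝ} {S : Set ℝ}
    (hSa : S ⊆ Ici a) (haS : a ∈ S) (hS : ∀ b ∈ S, HasCurve Z a c b) :
    ∃ h : ℝ → ℝ, LipschitzWith 1 h ∧ h a = c ∧ ∀ x ∈ S, (x, h x) ∈ Z := by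
  choose! H hl ha hz using hS
  have hlt : ∀ x ∈ S, ∀ y ∈ S, x ≤ y → H x x = H y x := fun x hx y hy hxy => by
    have hs : Icc a x ⊆ Icc a y := Icc_subset_Icc_right hxy
    exact hloc.eqOn_Icc (hl x hx).continuousOn ((hl y hy).continuousOn.mono hs) (hz x hx)
      (fun u hu => hz y hy u (hs hu)) ((ha x hx).trans (ha y hy).symm) (right_mem_Icc.2 (hSa hx))
  have hlip : LipschitzOnWith 1 (fun x => H x x) S := by
    refine LipschitzOnWith.of_dist_le_mul fun x hx y hy => ?_
    wlog hxy : x ≤ y generalizing x y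
    · rw [dist_comm, dist_comm x]
      exact this y hy x hx (le_of_not_ge hxy)
    rw [hlt x hx y hy hxy]
    exact (hl y hy).dist_le_mul x ⟨hSa hx, hxy⟩ y (right_mem_Icc.2 (hSa hy))
  obtain ⟨h, hh, heq⟩ := hlip.extend_real
  refine ⟨h, hh, (heq haS).symm.trans (ha a haS), fun x hx => ?_⟩
  rw [← heq hx]
  exact hz x hx x (right_mem_Icc.2 (hSa hx))

lemma HasCurve.exists_gt (hloc : IsLocalGraphSlopeLtOne Z) {a b c y : ℝ} (hab : a ≤ b)
    (hb : HasCurve Z a c b) (hy : b < y) : ∃ z ∈ Ioc b y, HasCurve Z a c z := by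
  obtain ⟨h, hl, ha, hz⟩ := hb
  obtain ⟨g, hg, hg1, hgb, hev⟩ := hloc _ (hz b (right_mem_Icc.2 hab))
  simp only at hg hg1 hgb
  obtain ⟨U, hU, hgU⟩ := (hg.of_le (by exact_mod_cast le_top) :
    ContDiffAt ℝ 1 g b).exists_lipschitzOnWith_of_nnnorm_lt 1 (by
      rw [← NNReal.coe_lt_coe, coe_nnnorm, ← norm_deriv_eq_norm_fderiv]
      simpa using hg1)
  have hgZ : ∀ᶠ u in 𝓝 b, (u, g u) ∈ Z := by
    have hc : ContinuousAt (fun u => (u, g u)) b := continuousAt_id.prodMk hg.continuousAt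
    rw [← hgb] at hev
    filter_upwards [hc.eventually hev] with u hu using hu.2 rfl
  obtain ⟨z, hbz, hzU⟩ := mem_nhdsGE_iff_exists_Icc_subset.1
    (mem_nhdsWithin_of_mem_nhds (inter_mem hU hgZ) : U ∩ {u | (u, g u) ∈ Z} ∈ 𝓝[≥] b)
  have hsub : Icc b (min z y) ⊆ U ∩ {u | (u, g u) ∈ Z} :=
    (Icc_subset_Icc_right (min_le_left _ _)).trans hzU
  refine ⟨min z y, ⟨lt_min hbz hy, min_le_right _ _⟩, fun u => if u ≤ b then h u else g u,
    LipschitzOnWith.of_dist_le_mul fun u hu v hv => ?_, by simp [hab, ha], fun u hu => ?_⟩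
  · have hbb : b ∈ U := (hsub (left_mem_Icc.2 (le_min hbz.le hy.le))).1
    wlog huv : u ≤ v generalizing u v
    · rw [dist_comm, dist_comm u]
      exact this v hv u hu (le_of_not_ge huv)
    by_cases hub : u ≤ b <;> by_cases hvb : v ≤ b
    · simpa [hub, hvb] using hl.dist_le_mul u ⟨hu.1, hub⟩ v ⟨hv.1, hvb⟩
    · have h1 := hl.dist_le_mul u ⟨hu.1, hub⟩ b (right_mem_Icc.2 hab)
      have h2 := hgU.dist_le_mul b hbb v (hsub ⟨(not_le.1 hvb).le, hv.2⟩).1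
      have h3 := dist_triangle (h u) (h b) (g v)
      rw [hgb] at h2
      have hbv := (not_le.1 hvb).le
      simp only [hub, hvb, if_true, if_false, NNReal.coe_one, one_mul, Real.dist_eq] at h1 h2 h3 ⊢
      rw [abs_of_nonpos (by linarith : u - b ≤ 0)] at h1
      rw [abs_of_nonpos (by linarith : b - v ≤ 0)] at h2
      rw [abs_of_nonpos (by linarith : u - v ≤ 0)]
      linarith
    · exact absurd (huv.trans hvb) hub
    · simpa [hub, hvb] using hgU.dist_le_mul u (hsub ⟨(not_le.1 hub).le, hu.2⟩).1
        v (hsub ⟨(not_le.1 hvb).le, hv.2⟩).1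
  · by_cases hub : u ≤ b
    · simpa [hub] using hz u ⟨hu.1, hub⟩
    · simpa [hub] using (hsub ⟨(not_le.1 hub).le, hu.2⟩).2

lemma hasCurve (hloc : IsLocalGraphSlopeLtOne Z) (hZ : IsClosed Z) {a c : ℝ}
    (hac : (a, c) ∈ Z) {b : ℝ} (hab : a ≤ b) : HasCurve Z a c b := by
  have h0 : HasCurve Z a c a := ⟨fun _ => c, (LipschitzWith.const' c).lipschitzOnWith, rfl,
    fun x hx => by rw [le_antisymm hx.2 hx.1]; exact hac⟩
  have hcl : IsClosed ({b | HasCurve Z a c b} ∩ Icc a b) := by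
    set S := {b | HasCurve Z a c b} ∩ Icc a b with hS
    refine isClosed_of_closure_subset fun s hs => ?_
    have hsab : s ∈ Icc a b := closure_minimal inter_subset_right isClosed_Icc hs
    refine ⟨?_, hsab⟩
    obtain ⟨h, hl, ha, hz⟩ := hloc.exists_lipschitzWith_of_hasCurve (S := S) (a := a) (c := c)
      (fun x hx => hx.2.1) ⟨h0, left_mem_Icc.2 hab⟩ fun x hx => hx.1
    refine ⟨h, hl.lipschitzOnWith, ha, fun x hx => ?_⟩
    have hc := hl.continuous
    have hxS : x ∈ closure S := by
      rcases hx.2.eq_or_lt with rfl | hxs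
      · exact hs
      obtain ⟨y, hxy, hyS⟩ := mem_closure_iff.1 hs (Ioi x) isOpen_Ioi hxs
      exact subset_closure ⟨HasCurve.mono hyS.1 (le_of_lt hxy), hx.1, hx.2.trans hsab.2⟩
    exact closure_minimal (t := (fun x => (x, h x)) ⁻¹' Z) hz (hZ.preimage (by fun_prop)) hxS
  refine hcl.Icc_subset_of_forall_exists_gt h0 (fun x hx y hy => ?_) (right_mem_Icc.2 hab)
  obtain ⟨z, hz, hcz⟩ := HasCurve.exists_gt hloc hx.2.1 hx.1 hy
  exact ⟨z, hcz, hz⟩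

lemma connectedComponentIn_eq_graph (hloc : IsLocalGraphSlopeLtOne Z) {h : ℝ → ℝ}
    (hh : Continuous h) (hz : ∀ x, (x, h x) ∈ Z) (x₀ : ℝ) :
    connectedComponentIn Z (x₀, h x₀) = {q | q.2 = h q.1} := by
  have hgraph : {q : ℝ × ℝ | q.2 = h q.1} = range fun x => (x, h x) := by
    ext ⟨x, y⟩
    simp [eq_comm]
  refine Subset.antisymm ?_ ?_
  · have hint : {q : ℝ × ℝ | q.2 = h q.1} ⊆ interior (Zᶜ ∪ {q | q.2 = h q.1}) := by
      rintro ⟨x, y⟩ (rfl : y = h x)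
      obtain ⟨g, -, -, -, hg⟩ := hloc _ (hz x)
      have he := eventually_eq_of_graph_subset hg hh.continuousWithinAt fun y (_ : y ∈ univ) => hz y
      rw [nhdsWithin_univ] at he
      rw [mem_interior_iff_mem_nhds]
      filter_upwards [hg, continuousAt_fst.eventually he] with v hv hv'
      by_cases hvZ : v ∈ Z
      · exact Or.inr ((hv.1 hvZ).symm.trans hv')
      · exact Or.inl hvZ
    have hcl : IsClosed {q : ℝ × ℝ | q.2 = h q.1} :=
      isClosed_eq continuous_snd (hh.comp continuous_fst)
    intro q hq
    by_contra hqn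
    obtain ⟨r, hr, hr₁, hr₂⟩ := isPreconnected_connectedComponentIn
      (interior (Zᶜ ∪ {q | q.2 = h q.1})) {q | q.2 = h q.1}ᶜ isOpen_interior hcl.isOpen_compl
      (fun v _ => (em (v.2 = h v.1)).imp (fun hv => hint hv) id)
      ⟨_, mem_connectedComponentIn (hz x₀), hint rfl⟩ ⟨q, hq, hqn⟩
    exact (interior_subset hr₁).elim (fun hrZ => hrZ (connectedComponentIn_subset _ _ hr)) hr₂
  · rw [hgraph]
    exact (isPreconnected_range (by fun_prop)).subset_connectedComponentIn ⟨x₀, rfl⟩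
      (range_subset_iff.2 hz)

/-- A component symmetric in the first coordinate of a closed local graph of slope less than one
is the graph of an even continuous function. -/
lemma exists_even_graph (hloc : IsLocalGraphSlopeLtOne Z) (hZ : IsClosed Z)
    (hsym : ∀ x y, (x, y) ∈ Z → (-x, y) ∈ Z) {q : ℝ × ℝ} (hq : q ∈ Z)
    (hqsym : (-q.1, q.2) ∈ connectedComponentIn Z q) :
    ∃ h : ℝ → ℝ, Continuous h ∧ (∀ x, h (-x) = h x) ∧ (∀ x, (x, h x) ∈ Z) ∧
      connectedComponentIn Z q = {v | v.2 = h v.1} := by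
  wlog hq0 : q.1 ≤ 0 generalizing q
  · have hcomp := connectedComponentIn_eq hqsym
    rw [hcomp]
    refine this (hsym _ _ hq) ?_ (by simp only; linarith)
    rw [← hcomp]
    simpa using mem_connectedComponentIn hq
  obtain ⟨k, hk, hkq, hkz⟩ := hloc.exists_lipschitzWith_of_hasCurve (S := Ici q.1) Subset.rfl
    self_mem_Ici fun b hb => hloc.hasCurve hZ hq hb
  have hkc := hk.continuous
  have hmem : (0, k 0) ∈ connectedComponentIn Z q := by
    refine ((isPreconnected_Ici (a := q.1)).image (fun x => (x, k x))
      (by fun_prop)).subset_connectedComponentIn ⟨q.1, self_mem_Ici, by simp [hkq]⟩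
      (image_subset_iff.2 hkz) ⟨0, hq0, rfl⟩
  have habs : ∀ x, (x, k |x|) ∈ Z := fun x => by
    have := hkz |x| (hq0.trans (abs_nonneg x))
    rcases abs_choice x with hx | hx
    · rwa [hx] at this ⊢
    · simpa [hx] using hsym _ _ this
  refine ⟨fun x => k |x|, by fun_prop, fun x => by simp, habs, ?_⟩
  rw [connectedComponentIn_eq hmem]
  simpa using hloc.connectedComponentIn_eq_graph (h := fun x => k |x|) (by fun_prop) habs 0

lemma contDiff_and_abs_deriv_lt_one (hloc : IsLocalGraphSlopeLtOne Z) {h : ℝ → ℝ}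
    (hh : Continuous h) (hz : ∀ x, (x, h x) ∈ Z) :
    ContDiff ℝ (⊤ : ℕ∞) h ∧ ∀ x, |deriv h x| < 1 := by
  have key : ∀ x, ContDiffAt ℝ (⊤ : ℕ∞) h x ∧ |deriv h x| < 1 := fun x => by
    obtain ⟨g, hg, hg1, -, hev⟩ := hloc _ (hz x)
    have he := eventually_eq_of_graph_subset hev hh.continuousWithinAt fun y (_ : y ∈ univ) => hz y
    rw [nhdsWithin_univ] at he
    have he : g =ᶠ[𝓝 x] h := he
    exact ⟨hg.congr_of_eventuallyEq he.symm, he.deriv_eq ▸ hg1⟩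
  exact ⟨contDiff_iff_contDiffAt.2 fun x => (key x).1, fun x => (key x).2⟩

end IsLocalGraphSlopeLtOne

/-- By the implicit function theorem, the zero set of a smooth function is a local graph of slope
less than one if the second partial derivative dominates the first one. -/
lemma isLocalGraphSlopeLtOne_zeros {F : ℝ × ℝ → ℝ} (hF : ContDiff ℝ (⊤ : ℕ∞) F)
    (hdom : ∀ q, F q = 0 → |fderiv ℝ F q (1, 0)| < |fderiv ℝ F q (0, 1)|) :
    IsLocalGraphSlopeLtOne (F ⁻¹' {0}) := by
  intro q hq
  have hq0 : F q = 0 := hq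
  have hlt := hdom q hq0
  have hne : fderiv ℝ F q (0, 1) ≠ 0 := abs_pos.1 ((abs_nonneg _).trans_lt hlt)
  have hinv : (fderiv ℝ F q ∘L .inr ℝ ℝ ℝ).IsInvertible := by
    refine ⟨ContinuousLinearEquiv.unitsEquivAut ℝ (Units.mk0 _ hne), ?_⟩
    ext
    simp
  have hFq := hF.contDiffAt (x := q)
  have hn : ((⊤ : ℕ∞) : WithTop ℕ∞) ≠ 0 := by simp
  have hself := hFq.implicitFunction_apply_self hn hinv
  have hev := hFq.eventually_apply_implicitFunction hn hinv
  have hiff := hFq.eventually_apply_eq_iff_implicitFunction hn hinv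
  have hcd := hFq.contDiffAt_implicitFunction hn hinv
  set g := hFq.implicitFunction hn hinv
  refine ⟨g, hcd, ?_, hself, ?_⟩
  · have hg := (hcd.differentiableAt hn).hasDerivAt
    have hF' : HasFDerivAt F (fderiv ℝ F q) (q.1, g q.1) := by
      rw [hself]
      exact (hF.differentiable hn q).hasFDerivAt
    have hcomp := hF'.comp_hasDerivAt q.1 ((hasDerivAt_id q.1).prodMk hg)
    have hzero : fderiv ℝ F q (1, deriv g q.1) = 0 :=
      hcomp.unique ((hasDerivAt_const q.1 (F q)).congr_of_eventuallyEq hev)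
    have hsplit : ((1, deriv g q.1) : ℝ × ℝ) = (1, 0) + deriv g q.1 • (0, 1) := by simp
    rw [hsplit, map_add, map_smul, smul_eq_mul] at hzero
    rw [eq_neg_of_add_eq_zero_left hzero, abs_neg, abs_mul] at hlt
    exact lt_of_mul_lt_mul_right (by linarith) (abs_nonneg (fderiv ℝ F q (0, 1)))
  · filter_upwards [hiff] with v hv
    rw [← hv, hq0]
    rfl

/-- The linear change of coordinates sending `((k₁ - k₂) / 2, (k₁ + k₂) / 2)` to `(k₁, k₂)`. -/
noncomputable def halfDiffHalfSum : (ℝ × ℝ) ≃ₜ (ℝ × ℝ) where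
  toFun v := (v.2 + v.1, v.2 - v.1)
  invFun q := ((q.1 - q.2) / 2, (q.1 + q.2) / 2)
  left_inv v := by ext <;> simp
  right_inv q := by ext <;> simp <;> ring
  continuous_toFun := by fun_prop
  continuous_invFun := by fun_prop

lemma isLocalGraphSlopeLtOne_of_elliptic {W : ℝ × ℝ → ℝ} (hW : ContDiff ℝ (⊤ : ℕ∞) W)
    (hell : ∀ p : ℝ × ℝ, W p = 0 →
      0 < deriv (fun x => W (x, p.2)) p.1 * deriv (fun y => W (p.1, y)) p.2) :
    IsLocalGraphSlopeLtOne ((W ∘ halfDiffHalfSum) ⁻¹' {0}) := by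
  let L : ℝ × ℝ →L[ℝ] ℝ × ℝ :=
    (ContinuousLinearMap.snd ℝ ℝ ℝ + ContinuousLinearMap.fst ℝ ℝ ℝ).prod
      (ContinuousLinearMap.snd ℝ ℝ ℝ - ContinuousLinearMap.fst ℝ ℝ ℝ)
  have hL : (halfDiffHalfSum : ℝ × ℝ → ℝ × ℝ) = L := rfl
  rw [hL]
  refine isLocalGraphSlopeLtOne_zeros (hW.comp L.contDiff) fun q hq => ?_
  have hD : HasFDerivAt W (fderiv ℝ W (L q)) (L q) :=
    (hW.differentiable (by simp) _).hasFDerivAt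
  have h1 : deriv (fun x => W (x, (L q).2)) (L q).1 = fderiv ℝ W (L q) (1, 0) :=
    (HasFDerivAt.comp_hasDerivAt (f := fun x => (x, (L q).2)) (L q).1 hD
      ((hasDerivAt_id _).prodMk (hasDerivAt_const _ _))).deriv
  have h2 : deriv (fun y => W ((L q).1, y)) (L q).2 = fderiv ℝ W (L q) (0, 1) :=
    (HasFDerivAt.comp_hasDerivAt (f := fun y => ((L q).1, y)) (L q).2 hD
      ((hasDerivAt_const _ _).prodMk (hasDerivAt_id _))).deriv
  have hpos := hell (L q) hq
  rw [h1, h2] at hpos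
  have e1 : L (1, 0) = (1, 0) - (0, 1) := by simp [L]
  have e2 : L (0, 1) = (1, 0) + (0, 1) := by simp [L]
  rw [(hD.comp q L.hasFDerivAt).fderiv, ContinuousLinearMap.comp_apply,
    ContinuousLinearMap.comp_apply, e1, e2, map_sub, map_add]
  exact sq_lt_sq.1 (by nlinarith)

/-- A symmetric connected component `Γ` of the zero set of an elliptic Weingarten
functional `W` is the graph `(k₁+k₂)/2 = φ((k₁−k₂)²/4)` of a smooth function `φ` on
`[0,∞)` satisfying the ellipticity condition `4t·φ'(t)² < 1`. -/
theorem weingarten_component_graph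
    (W : ℝ × ℝ → ℝ) (hW : ContDiff ℝ (⊤ : ℕ∞) W)
    (hsym : ∀ k₁ k₂ : ℝ, W (k₁, k₂) = W (k₂, k₁))
    (hell : ∀ p : ℝ × ℝ, W p = 0 →
      0 < deriv (fun x => W (x, p.2)) p.1 * deriv (fun y => W (p.1, y)) p.2)
    (Γ : Set (ℝ × ℝ)) (p : ℝ × ℝ) (hp : W p = 0)
    (hΓ : Γ = connectedComponentIn (W ⁻¹' {0}) p)
    (hΓsym : ∀ q : ℝ × ℝ, q ∈ Γ → (q.2, q.1) ∈ Γ) :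
    ∃ φ : ℝ → ℝ, ContDiffOn ℝ (⊤ : ℕ∞) φ (Set.Ici 0) ∧
      (∀ t : ℝ, 0 ≤ t → 4 * t * (derivWithin φ (Set.Ici 0) t) ^ 2 < 1) ∧
      Γ = {q : ℝ × ℝ | (q.1 + q.2) / 2 = φ ((q.1 - q.2) ^ 2 / 4)} := by
  have hsurj := halfDiffHalfSum.surjective
  obtain ⟨q, rfl⟩ := hsurj p
  have hloc := isLocalGraphSlopeLtOne_of_elliptic hW hell
  set Z := (W ∘ halfDiffHalfSum) ⁻¹' {0} with hZ
  have hZcl : IsClosed Z :=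
    isClosed_singleton.preimage (hW.continuous.comp halfDiffHalfSum.continuous)
  have hqZ : q ∈ Z := hp
  have hswap : ∀ x y : ℝ, halfDiffHalfSum (-x, y) =
      ((halfDiffHalfSum (x, y)).2, (halfDiffHalfSum (x, y)).1) := fun x y => by
    simp [halfDiffHalfSum, sub_eq_add_neg]
  have hΓimage : Γ = halfDiffHalfSum '' connectedComponentIn Z q := by
    rw [hΓ, halfDiffHalfSum.image_connectedComponentIn hqZ, hZ, preimage_comp,
      image_preimage_eq _ hsurj]
  have hmem : ∀ v, halfDiffHalfSum v ∈ Γ ↔ v ∈ connectedComponentIn Z q := fun v => by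
    rw [hΓimage, halfDiffHalfSum.injective.mem_set_image]
  obtain ⟨h, hc, heven, hz, hgraph⟩ := hloc.exists_even_graph hZcl (fun x y hxy => by
      change W (halfDiffHalfSum (-x, y)) = 0
      rw [hswap, hsym]
      exact hxy) hqZ (by
      rw [← hmem, hswap]
      exact hΓsym _ ((hmem q).2 (mem_connectedComponentIn hqZ)))
  obtain ⟨hh, hslope⟩ := hloc.contDiff_and_abs_deriv_lt_one hc hz
  refine ⟨fun t => h √t, contDiffOn_comp_sqrt_of_even hh heven, fun t ht => ?_, ?_⟩
  · obtain ⟨k, hk, -, hhk⟩ := exists_even_deriv_eq_mul hh heven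
    rw [(hasDerivWithinAt_comp_sqrt hh hk.continuous hhk ht).derivWithin (uniqueDiffOn_Ici 0 t ht)]
    have hlt := (sq_lt_one_iff_abs_lt_one _).2 (hslope √t)
    rw [hhk, mul_pow, Real.sq_sqrt ht] at hlt
    linarith
  · ext r
    obtain ⟨⟨x, y⟩, rfl⟩ := hsurj r
    rw [hmem, hgraph]
    have h1 : (y + x + (y - x)) / 2 = y := by ring
    have h2 : (y + x - (y - x)) ^ 2 / 4 = x ^ 2 := by ring
    have h3 : h |x| = h x := by rcases abs_choice x with hx | hx <;> rw [hx]; exact heven x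
    change y = h x ↔ (y + x + (y - x)) / 2 = h √((y + x - (y - x)) ^ 2 / 4)
    rw [h1, h2, Real.sqrt_sq_eq_abs, h3]
end
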